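/- arXiv:1710.04797 — 7 statements merged into one kernel-verified Lean document; each statement's English description precedes it below -/
import Mathlib

section
/- For all integers k ≥ 2 and m ≥ 1, there exist a finite nonempty set V, an asymmetric relation A on V (an oriented digraph), and a group G acting faithfully on V by permutations preserving A, such that: the digraph is connected (the equivalence relation generated by A relates any two vertices of V), G acts transitively on V and transitively on the set of arcs A ⊆ V × V, every vertex has exactly k out-neighbours, and there exists a block of imprimitivity B ⊆ V for the action of G with |B| = m. -/
def affG (k N : ℕ) : Subgroup (Equiv.Perm (Fin k → ZMod N)) where
  carrier := {σ | ∃ (π : Equiv.Perm (Fin k)) (t : Fin k → ZMod N), ∀ x i, σ x i = x (π i) + t i}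
  one_mem' := ⟨1, 0, fun x i => by simp⟩
  mul_mem' := by
    rintro σ τ ⟨π, t, h⟩ ⟨π', t', h'⟩
    refine ⟨π' * π, fun i => t' (π i) + t i, fun x i => ?_⟩
    simp [h, h', add_assoc]
  inv_mem' := by
    rintro σ ⟨π, t, h⟩
    refine ⟨π⁻¹, fun i => - t (π⁻¹ i), fun x i => ?_⟩
    have := h (σ⁻¹ x) (π⁻¹ i)
    simp at this
    simp [this]

def affP {k N : ℕ} (π : Equiv.Perm (Fin k)) (t : Fin k → ZMod N) :
    Equiv.Perm (Fin k → ZMod N) where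
  toFun x i := x (π i) + t i
  invFun x i := x (π⁻¹ i) - t (π⁻¹ i)
  left_inv x := by ext i; simp
  right_inv x := by ext i; simp

theorem affP_mem {k N : ℕ} (π : Equiv.Perm (Fin k)) (t : Fin k → ZMod N) :
    affP π t ∈ affG k N := ⟨π, t, fun _ _ => rfl⟩

theorem single_conn {k N : ℕ} [NeZero N] (u v : Fin k → ZMod N) :
    Relation.EqvGen (fun u v : Fin k → ZMod N => ∃ i, v = u + Pi.single i 1) u v := by
  let S : AddSubgroup (Fin k → ZMod N) :=
    { carrier := {t | ∀ u, Relation.EqvGen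
        (fun u v : Fin k → ZMod N => ∃ i, v = u + Pi.single i 1) u (u + t)}
      zero_mem' := fun u => by simpa using Relation.EqvGen.refl u
      add_mem' := by
        intro a b ha hb u
        rw [← add_assoc]
        exact (ha u).trans _ _ _ (hb _)
      neg_mem' := by
        intro a ha u
        have := ha (u + -a)
        rw [neg_add_cancel_right] at this
        exact this.symm _ _ }
  have h1 : ∀ i, (Pi.single i 1 : Fin k → ZMod N) ∈ S := fun i u => .rel _ _ ⟨i, rfl⟩
  have h2 : ∀ i (a : ZMod N), (Pi.single i a : Fin k → ZMod N) ∈ S := by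
    intro i a
    have := S.nsmul_mem (h1 i) a.val
    rw [← Pi.single_smul] at this
    simpa using this
  have h3 : v - u ∈ S := by
    rw [← Finset.univ_sum_single (v - u)]
    exact S.sum_mem fun i _ => h2 i _
  simpa using h3 u

/-- For all integers `k ≥ 2` and `m ≥ 1`, there exist a finite nonempty set
`V`, an asymmetric arc relation `A` on `V` (an oriented digraph), and a group
`G` of permutations of `V` (so `G` acts faithfully) preserving `A`, such that
the digraph is connected, `G` is transitive on vertices and on arcs, every
vertex has exactly `k` out-neighbours, and `G` admits a block of imprimitivity
of size `m`. -/
theorem exists_arc_transitive_oriented_digraph (k m : ℕ) (hk : 2 ≤ k)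
    (hm : 1 ≤ m) :
    ∃ (V : Type) (_ : Fintype V) (_ : Nonempty V) (A : V → V → Prop)
      (G : Subgroup (Equiv.Perm V)),
      (∀ u v : V, A u v → ¬ A v u) ∧
      (∀ σ ∈ G, ∀ u v : V, A u v → A (σ u) (σ v)) ∧
      (∀ u v : V, Relation.EqvGen A u v) ∧
      (∀ u v : V, ∃ σ ∈ G, σ u = v) ∧
      (∀ u v u' v' : V, A u v → A u' v' → ∃ σ ∈ G, σ u = u' ∧ σ v = v') ∧
      (∀ u : V, {v | A u v}.ncard = k) ∧
      ∃ B : Set V, B.Nonempty ∧ B.ncard = m ∧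
        ∀ σ ∈ G, σ '' B = B ∨ Disjoint (σ '' B) B := by
  have : NeZero (3 * m) := ⟨by omega⟩
  have : Fact (1 < 3 * m) := ⟨by omega⟩
  have : NeZero k := ⟨by omega⟩
  have h2 : (1 + 1 : ZMod (3 * m)) ≠ 0 := by
    intro h
    have h' : ((2 : ℕ) : ZMod (3 * m)) = 0 := by rw [← h]; norm_num
    rw [ZMod.natCast_eq_zero_iff] at h'
    have := Nat.le_of_dvd (by norm_num) h'
    omega
  refine ⟨Fin k → ZMod (3 * m), inferInstance, inferInstance,
    fun u v => ∃ i, v = u + Pi.single i 1, affG k (3 * m), ?_, ?_, single_conn, ?_, ?_, ?_, ?_⟩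
  · rintro u v ⟨i, rfl⟩ ⟨j, h⟩
    have := congrFun h i
    by_cases hij : i = j
    · subst hij
      simp [add_assoc] at this
      exact h2 this
    · simp [hij] at this
  · rintro σ ⟨π, t, h⟩ u v ⟨i, rfl⟩
    refine ⟨π⁻¹ i, ?_⟩
    ext j
    have : (Pi.single i 1 : Fin k → ZMod (3 * m)) (π j)
        = (Pi.single (π⁻¹ i) 1 : Fin k → ZMod (3 * m)) j := by
      simp only [Pi.single_apply, Equiv.Perm.eq_inv_iff_eq]
    rw [Pi.add_apply, h, h, Pi.add_apply, this]
    ring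
  · intro u v
    exact ⟨affP 1 (v - u), affP_mem _ _, by ext i; simp [affP]⟩
  · rintro u v u' v' ⟨i, rfl⟩ ⟨j, rfl⟩
    refine ⟨affP (Equiv.swap i j) (fun l => u' l - u (Equiv.swap i j l)), affP_mem _ _, ?_, ?_⟩
    · ext l; simp [affP]
    · ext l
      have : (Pi.single i 1 : Fin k → ZMod (3 * m)) (Equiv.swap i j l)
        = (Pi.single j 1 : Fin k → ZMod (3 * m)) l := by
        simp only [Pi.single_apply, Equiv.swap_apply_eq_iff, Equiv.swap_apply_left]
      simp only [affP, Equiv.coe_fn_mk, Pi.add_apply, this]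
      ring
  · intro u
    have : {v : Fin k → ZMod (3 * m) | ∃ i, v = u + Pi.single i 1}
        = (fun i => u + Pi.single i 1) '' (Set.univ : Set (Fin k)) := by
      ext v; simp [eq_comm]
    rw [this, Set.ncard_image_of_injective, Set.ncard_univ, Nat.card_fin]
    intro i j h
    by_contra hij
    have := congrFun h i
    simp [hij] at this
  · let Z := AddSubgroup.zmultiples (3 : ZMod (3 * m))
    refine ⟨(fun a _ => a) '' (Z : Set (ZMod (3 * m))), ⟨_, 0, Z.zero_mem, rfl⟩, ?_, ?_⟩
    · rw [Set.ncard_image_of_injective]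
      · have h : Nat.card Z = m := by
          rw [Nat.card_zmultiples]
          have := ZMod.addOrderOf_coe 3 (n := 3 * m) (by omega)
          rw [Nat.cast_ofNat] at this
          rw [this]
          simp
        exact h
      · intro a b h
        exact congrFun h 0
    · rintro σ ⟨π, t, h⟩
      by_cases ht : ∃ a ∈ Z, ∀ i, t i = a
      · left
        obtain ⟨a, ha, ht⟩ := ht
        ext x
        constructor
        · rintro ⟨_, ⟨b, hb, rfl⟩, rfl⟩
          exact ⟨b + a, Z.add_mem hb ha, by ext i; simp [h, ht]⟩
        · rintro ⟨b, hb, rfl⟩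
          exact ⟨_, ⟨b - a, Z.sub_mem hb ha, rfl⟩, by ext i; simp [h, ht]⟩
      · right
        rw [Set.disjoint_left]
        rintro _ ⟨_, ⟨b, hb, rfl⟩, rfl⟩ ⟨c, hc, hcc⟩
        apply ht
        refine ⟨c - b, Z.sub_mem hc hb, fun i => ?_⟩
        have := congrFun hcc i
        simp only [h] at this
        rw [this]; ring
end

section
/- For all integers k ≥ 2 and m ≥ 1, there exist a finite connected simple graph Γ = (V, E) which is regular of valency k, and a group G of automorphisms of Γ, such that G acts transitively on V, G acts transitively on the set of ordered pairs (u,v) of adjacent vertices of Γ, and there exists a block of imprimitivity B ⊆ V for the action of G with |B| = m. -/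
def ArcConcl (k m : ℕ) : Prop :=
    ∃ (V : Type) (_ : Fintype V) (Γ : SimpleGraph V)
      (G : Subgroup (Equiv.Perm V)),
      Γ.Connected ∧
      (∀ v : V, (Γ.neighborSet v).ncard = k) ∧
      (∀ σ ∈ G, ∀ u v : V, Γ.Adj u v ↔ Γ.Adj (σ u) (σ v)) ∧
      (∀ u v : V, ∃ σ ∈ G, σ u = v) ∧
      (∀ u v u' v' : V, Γ.Adj u v → Γ.Adj u' v' →
        ∃ σ ∈ G, σ u = u' ∧ σ v = v') ∧
      ∃ B : Set V, B.Nonempty ∧ B.ncard = m ∧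
        ∀ σ ∈ G, σ '' B = B ∨ Disjoint (σ '' B) B

theorem arc_coset (k m : ℕ) (hk : 2 ≤ k) (P : Type) [Group P] [Finite P]
    (L H : Subgroup P) (g : P) (hg : g * g = 1)
    (hgL : ∀ x ∈ L, g * x * g ∈ L → x = 1)
    (hLH : L ≤ H) (hgen : Subgroup.closure ((L : Set P) ∪ {g}) = ⊤)
    (hcL : Nat.card L = k) (hcH : L.relIndex H = m) : ArcConcl k m := by
  classical
  have hgi : g⁻¹ = g := inv_eq_of_mul_eq_one_left hg
  have hgn : g ∉ L := by
    intro h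
    have h1 : g = 1 := hgL g h (by simpa [hg] using h)
    have : L = ⊥ := by
      rw [Subgroup.eq_bot_iff_forall]
      intro x hx
      exact hgL x hx (by simpa [h1] using hx)
    subst this
    simp at hcL
    omega
  let Γ : SimpleGraph (P ⧸ L) :=
    { Adj := fun u v => ∃ x : P, u = (x : P ⧸ L) ∧ v = ((x * g : P) : P ⧸ L)
      symm := ⟨by
        rintro u v ⟨x, rfl, rfl⟩
        exact ⟨x * g, rfl, by rw [mul_assoc, hg, mul_one]⟩⟩
      loopless := ⟨by
        rintro u ⟨x, rfl, h⟩
        rw [QuotientGroup.eq] at h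
        simp at h
        exact hgn h⟩ }
  have hadj : ∀ u v, Γ.Adj u v ↔ ∃ x : P, u = (x : P ⧸ L) ∧ v = ((x * g : P) : P ⧸ L) :=
    fun _ _ => Iff.rfl
  have himp : ∀ (p : P) u v, Γ.Adj u v → Γ.Adj (p • u) (p • v) := by
    rintro p u v ⟨x, rfl, rfl⟩
    exact ⟨p * x, rfl, by rw [mul_assoc]; rfl⟩
  refine ⟨P ⧸ L, Fintype.ofFinite _, Γ, (MulAction.toPermHom P (P ⧸ L)).range, ?_, ?_, ?_, ?_, ?_,
    (fun h : P => (h : P ⧸ L)) '' (H : Set P), ?_, ?_, ?_⟩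
  · have key : ∀ x ∈ Subgroup.closure ((L : Set P) ∪ {g}), ∀ y : P,
        Γ.Reachable (y : P ⧸ L) ((y * x : P) : P ⧸ L) := by
      intro x hx
      induction hx using Subgroup.closure_induction with
      | mem x hx =>
        intro y
        rcases hx with hx | hx
        · have : ((y * x : P) : P ⧸ L) = y := by
            rw [eq_comm, QuotientGroup.eq]; simpa using hx
          rw [this]
        · rw [Set.mem_singleton_iff] at hx
          subst hx
          exact SimpleGraph.Adj.reachable ⟨y, rfl, rfl⟩
      | one => intro y; simp
      | mul a b _ _ ha hb =>
        intro y
        rw [← mul_assoc]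
        exact (ha y).trans (hb _)
      | inv a _ ha =>
        intro y
        have := ha (y * a⁻¹)
        simp only [inv_mul_cancel_right] at this
        exact this.symm
    have : Nonempty (P ⧸ L) := ⟨((1 : P) : P ⧸ L)⟩
    refine SimpleGraph.Connected.mk ?_
    intro u v
    induction u using QuotientGroup.induction_on with | _ x
    induction v using QuotientGroup.induction_on with | _ y
    have := key (x⁻¹ * y) (by rw [hgen]; trivial) x
    simpa using this
  · intro v
    induction v using QuotientGroup.induction_on with | _ y
    have : Γ.neighborSet (y : P ⧸ L) = Set.range (fun l : L => ((y * l * g : P) : P ⧸ L)) := by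
      ext w
      simp only [SimpleGraph.mem_neighborSet, hadj, Set.mem_range]
      constructor
      · rintro ⟨x, h1, rfl⟩
        rw [QuotientGroup.eq] at h1
        exact ⟨⟨_, h1⟩, by simp⟩
      · rintro ⟨l, rfl⟩
        exact ⟨y * l, by rw [QuotientGroup.eq]; simp, rfl⟩
    rw [this, ← Set.image_univ, Set.ncard_image_of_injective, Set.ncard_univ, hcL]
    intro l l' h
    simp only at h
    rw [QuotientGroup.eq] at h
    have h2 := hgL ((l : P)⁻¹ * l') (L.mul_mem (L.inv_mem l.2) l'.2) (by
      convert h using 1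
      simp [hgi, mul_assoc])
    exact Subtype.ext (inv_mul_eq_one.mp h2)
  · rintro _ ⟨p, rfl⟩ u v
    refine ⟨himp p u v, fun h => ?_⟩
    have := himp p⁻¹ _ _ h
    simpa using this
  · intro u v
    obtain ⟨p, hp⟩ := MulAction.exists_smul_eq P u v
    exact ⟨_, ⟨p, rfl⟩, hp⟩
  · rintro u v u' v' ⟨x, rfl, rfl⟩ ⟨y, rfl, rfl⟩
    refine ⟨_, ⟨y * x⁻¹, rfl⟩, ?_, ?_⟩
    · change ((y * x⁻¹ * x : P) : P ⧸ L) = _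
      simp
    · change ((y * x⁻¹ * (x * g) : P) : P ⧸ L) = _
      simp [mul_assoc]
  · exact ⟨_, 1, H.one_mem, rfl⟩
  · rw [← hcH]
    have : (fun h : P => (h : P ⧸ L)) '' (H : Set P)
        = Set.range (Subgroup.quotientSubgroupOfEmbeddingOfLE L (le_refl H) |> fun _ =>
          (fun q : H ⧸ L.subgroupOf H => Quotient.liftOn' q (fun h : H => ((h : P) : P ⧸ L))
            (by
              intro a b hab
              rw [QuotientGroup.leftRel_apply] at hab
              exact QuotientGroup.eq.2 hab))) := by
      ext w
      constructor
      · rintro ⟨h, hh, rfl⟩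
        exact ⟨((⟨h, hh⟩ : H) : H ⧸ L.subgroupOf H), rfl⟩
      · rintro ⟨q, rfl⟩
        induction q using QuotientGroup.induction_on with | _ h
        exact ⟨h, h.2, rfl⟩
    rw [this, ← Set.image_univ, Set.ncard_image_of_injective, Set.ncard_univ]
    · rfl
    · intro q r
      induction q using QuotientGroup.induction_on with | _ h
      induction r using QuotientGroup.induction_on with | _ h'
      intro e
      have e' : ((h : P) : P ⧸ L) = ((h' : P) : P ⧸ L) := e
      rw [QuotientGroup.eq] at e'
      exact QuotientGroup.eq.2 e'
  · rintro _ ⟨p, rfl⟩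
    by_cases hp : p ∈ H
    · left
      ext w
      constructor
      · rintro ⟨_, ⟨h, hh, rfl⟩, rfl⟩
        exact ⟨p * h, H.mul_mem hp hh, rfl⟩
      · rintro ⟨h, hh, rfl⟩
        refine ⟨_, ⟨p⁻¹ * h, H.mul_mem (H.inv_mem hp) hh, rfl⟩, ?_⟩
        change ((p * (p⁻¹ * h) : P) : P ⧸ L) = _
        simp
    · right
      rw [Set.disjoint_left]
      rintro _ ⟨_, ⟨h, hh, rfl⟩, rfl⟩ ⟨h', hh', e⟩
      have e' : ((h' : P) : P ⧸ L) = ((p * h : P) : P ⧸ L) := e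
      rw [QuotientGroup.eq] at e'
      have := H.mul_mem (H.mul_mem hh' (hLH e')) (H.inv_mem hh)
      apply hp
      simpa [mul_assoc] using this

theorem exists_relIndex_comm {P : Type} [Group P] (a z : P) (m : ℕ) (hm : 1 ≤ m)
    (hc : Commute a z) (hz : ∀ n : ℤ, z ^ n ∈ Subgroup.zpowers a ↔ (m : ℤ) ∣ n) :
    ∃ H : Subgroup P, Subgroup.zpowers a ≤ H ∧ (Subgroup.zpowers a).relIndex H = m := by
  let H : Subgroup P :=
    { carrier := {x | ∃ i j : ℤ, x = z ^ i * a ^ j}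
      one_mem' := ⟨0, 0, by simp⟩
      mul_mem' := by
        rintro _ _ ⟨i, j, rfl⟩ ⟨i', j', rfl⟩
        refine ⟨i + i', j + j', ?_⟩
        have := ((hc.zpow_left j).zpow_right i').eq
        rw [zpow_add, zpow_add, mul_assoc, ← mul_assoc (a ^ j), this]
        simp only [mul_assoc]
      inv_mem' := by
        rintro _ ⟨i, j, rfl⟩
        refine ⟨-i, -j, ?_⟩
        have := ((hc.zpow_left (-j)).zpow_right (-i)).eq
        rw [mul_inv_rev, ← this]
        simp }
  have hzH : ∀ i : ℤ, z ^ i ∈ H := fun i => ⟨i, 0, by simp⟩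
  refine ⟨H, ?_, ?_⟩
  · rintro _ ⟨j, rfl⟩
    exact ⟨0, j, by simp⟩
  · let f : Fin m → H ⧸ (Subgroup.zpowers a).subgroupOf H := fun i =>
      ((⟨z ^ ((i : ℕ) : ℤ), hzH _⟩ : H) : H ⧸ (Subgroup.zpowers a).subgroupOf H)
    have hf : Function.Bijective f := by
      constructor
      · intro i j hij
        have h1 := QuotientGroup.eq.1 hij
        have h2 : (z ^ ((i : ℕ) : ℤ))⁻¹ * z ^ ((j : ℕ) : ℤ) ∈ Subgroup.zpowers a := h1
        rw [← zpow_neg, ← zpow_add, hz] at h2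
        apply Fin.ext
        obtain ⟨c, hc⟩ := h2
        have hi := i.2
        have hj := j.2
        have : c = 0 := by
          have h3 : (m : ℤ) * c < m * 1 := by omega
          have h4 : (m : ℤ) * (-1) < m * c := by omega
          have h5 := lt_of_mul_lt_mul_left h3 (by omega)
          have h6 := lt_of_mul_lt_mul_left h4 (by omega)
          omega
        subst this
        omega
      · intro q
        induction q using QuotientGroup.induction_on with | _ h
        obtain ⟨h, i, j, rfl⟩ := h
        have hm' : (m : ℤ) ≠ 0 := by omega
        have h0 := Int.emod_nonneg i hm'
        have h1 := Int.emod_lt_of_pos i (show (0 : ℤ) < m by omega)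
        refine ⟨⟨(i % m).toNat, by omega⟩, ?_⟩
        refine QuotientGroup.eq.2 ?_
        change (z ^ (((i % m).toNat : ℕ) : ℤ))⁻¹ * (z ^ i * a ^ j) ∈ Subgroup.zpowers a
        rw [Int.toNat_of_nonneg h0, ← mul_assoc, ← zpow_neg, ← zpow_add]
        refine Subgroup.mul_mem _ ((hz _).2 ?_) ⟨j, rfl⟩
        exact ⟨i / m, by have := Int.emod_add_mul_ediv i m; linarith⟩
    have := Nat.card_congr (Equiv.ofBijective f hf)
    rw [Nat.card_fin] at this
    exact this.symm

theorem arc_elem (k m : ℕ) (hk : 2 ≤ k) (hm : 1 ≤ m) (X : Type) [Group X] [Finite X]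
    (a g z : X) (ha : orderOf a = k) (hg : g * g = 1)
    (hag : ∀ i : ℤ, g * a ^ i * g ∈ Subgroup.zpowers a → a ^ i = 1)
    (hzP : z ∈ Subgroup.closure {a, g}) (hc : Commute a z)
    (hz : ∀ n : ℤ, z ^ n ∈ Subgroup.zpowers a ↔ (m : ℤ) ∣ n) : ArcConcl k m := by
  let P := Subgroup.closure {a, g}
  let a' : P := ⟨a, Subgroup.subset_closure (by simp)⟩
  let g' : P := ⟨g, Subgroup.subset_closure (by simp)⟩
  let z' : P := ⟨z, hzP⟩
  have hmem : ∀ x : P, x ∈ Subgroup.zpowers a' ↔ (x : X) ∈ Subgroup.zpowers a := by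
    intro x
    simp only [Subgroup.mem_zpowers_iff, Subtype.ext_iff, Subgroup.coe_zpow, a']
  obtain ⟨H, hH1, hH2⟩ := exists_relIndex_comm a' z' m hm (Subtype.ext hc)
    (fun n => by rw [hmem]; exact hz n)
  refine arc_coset k m hk P (Subgroup.zpowers a') H g'
    (Subtype.ext hg) ?_ hH1 ?_ ?_ hH2
  · rintro _ ⟨i, rfl⟩ h
    rw [hmem] at h
    exact Subtype.ext (hag i h)
  · have h := Subgroup.closure_closure_coe_preimage (k := ({a, g} : Set X))
    rw [eq_top_iff, ← h, Subgroup.closure_le]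
    rintro x hx
    apply Subgroup.subset_closure
    rcases hx with hx | hx
    · left
      exact (hmem x).2 (by rw [hx]; exact Subgroup.mem_zpowers a)
    · right
      exact Subtype.ext hx
  · rw [Nat.card_zpowers, ← ha]
    exact (Subgroup.orderOf_coe a').symm

/-- The cyclic shift. -/
def arcA (k M : ℕ) : Equiv.Perm ((ZMod k → ZMod M) × ZMod M) where
  toFun p := (fun i => p.1 (i - 1), p.2)
  invFun p := (fun i => p.1 (i + 1), p.2)
  left_inv p := by simp
  right_inv p := by simp

/-- Basis vector. -/
def arcE (k M : ℕ) (i : ZMod k) : ZMod k → ZMod M := fun j => if j = i then 1 else 0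

/-- The twisted reflections, for `k ≥ 2`. -/
def arcG (k M : ℕ) (hk : 2 ≤ k) (i : ZMod k) : Equiv.Perm ((ZMod k → ZMod M) × ZMod M) :=
  have h10 : i + 1 ≠ i := by
    have : Fact (1 < k) := ⟨by omega⟩
    simp
  have h : ∀ p : (ZMod k → ZMod M) × ZMod M,
    (arcE k M i - (arcE k M i - p.1), (p.2 - p.1 (i + 1)) - (arcE k M i - p.1) (i + 1)) = p := by
      intro p
      ext
      · simp
      · simp only [arcE, Pi.sub_apply, h10, if_false]
        ring
  { toFun := fun p => (arcE k M i - p.1, p.2 - p.1 (i + 1))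
    invFun := fun p => (arcE k M i - p.1, p.2 - p.1 (i + 1))
    left_inv := h
    right_inv := h }

theorem arcA_zpow (k M : ℕ) (n : ℤ) (p : (ZMod k → ZMod M) × ZMod M) :
    (arcA k M ^ n) p = (fun i => p.1 (i - n), p.2) := by
  induction n using Int.induction_on generalizing p with
  | zero => simp
  | succ n ih =>
    rw [zpow_add_one, Equiv.Perm.mul_apply, ih]
    simp [arcA, sub_sub]
  | pred n ih =>
    rw [zpow_sub_one, Equiv.Perm.mul_apply, ih]
    have : ∀ q, (arcA k M)⁻¹ q = (fun i => q.1 (i + 1), q.2) := fun q => rfl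
    rw [this]
    ext i
    · simp only
      push_cast
      ring_nf
    · rfl

theorem arcG_apply (k M : ℕ) (hk : 2 ≤ k) (i : ZMod k) (p : (ZMod k → ZMod M) × ZMod M) :
    arcG k M hk i p = (arcE k M i - p.1, p.2 - p.1 (i + 1)) := rfl

theorem arcG_conj (k M : ℕ) (hk : 2 ≤ k) (n : ℤ) :
    arcG k M hk n = arcA k M ^ n * arcG k M hk 0 * arcA k M ^ (-n) := by
  ext p i
  · simp only [Equiv.Perm.mul_apply, arcA_zpow, arcG_apply]
    simp [arcE, sub_eq_zero]
  · simp only [Equiv.Perm.mul_apply, arcA_zpow, arcG_apply]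
    simp [add_comm]

theorem arcZ_apply (k M : ℕ) (hk : 3 ≤ k) (p : (ZMod k → ZMod M) × ZMod M) :
    ((arcG k M (by omega) 0 * arcG k M (by omega) 2 * arcG k M (by omega) 1) ^ 2) p =
      (p.1, p.2 + ((if k = 3 then 3 else 2 : ℕ) : ZMod M)) := by
  have hne : ∀ a b : ℕ, a < k → b < k → a ≠ b → (a : ZMod k) ≠ b := by
    intro a b ha hb hab h
    rw [ZMod.natCast_eq_natCast_iff'] at h
    rw [Nat.mod_eq_of_lt ha, Nat.mod_eq_of_lt hb] at h
    exact hab h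
  have h10 : (1 : ZMod k) ≠ 0 := by simpa using hne 1 0 (by omega) (by omega) (by omega)
  have h20 : (2 : ZMod k) ≠ 0 := by simpa using hne 2 0 (by omega) (by omega) (by omega)
  have h21 : (2 : ZMod k) ≠ 1 := by simpa using hne 2 1 (by omega) (by omega) (by omega)
  have h31 : (3 : ZMod k) ≠ 1 := by
    intro h; apply h20; linear_combination h
  have h32 : (3 : ZMod k) ≠ 2 := by
    intro h; apply h10; linear_combination h
  have e2 : (1 : ZMod k) + 1 = 2 := by norm_num
  have e3 : (2 : ZMod k) + 1 = 3 := by norm_num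
  have h30 : (3 : ZMod k) = 0 ↔ k = 3 := by
    constructor
    · intro h
      have : ((3 : ℕ) : ZMod k) = 0 := by exact_mod_cast h
      rw [ZMod.natCast_eq_zero_iff] at this
      have := Nat.le_of_dvd (by norm_num) this
      omega
    · rintro rfl; rfl
  simp only [pow_two, Equiv.Perm.mul_apply, arcG_apply]
  ext i
  · simp only [Pi.sub_apply]; ring
  · simp only [Pi.sub_apply, arcE, e2, e3, zero_add, h10, h20, h21, h31, h32, h21.symm,
      if_true, if_false, h30]
    split_ifs <;> push_cast <;> ring

theorem arc_three (k m : ℕ) (hk : 3 ≤ k) (hm : 1 ≤ m) : ArcConcl k m := by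
  obtain ⟨c, hcdef⟩ : ∃ c : ℕ, c = if k = 3 then 3 else 2 := ⟨_, rfl⟩
  have hc0 : 0 < c := by rw [hcdef]; split_ifs <;> omega
  have hk2 : 2 ≤ k := by omega
  have hc2 : 2 ≤ c := by rw [hcdef]; split_ifs <;> omega
  let M := c * m
  have hM2 : 1 < M := by
    have : 2 * 1 ≤ c * m := Nat.mul_le_mul hc2 hm
    exact this
  have : Fact (1 < M) := ⟨hM2⟩
  have h1M : (1 : ZMod M) ≠ 0 := one_ne_zero
  have : NeZero M := ⟨by positivity⟩
  have : NeZero k := ⟨by omega⟩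
  let z := (arcG k M hk2 0 * arcG k M hk2 2 * arcG k M hk2 1) ^ 2
  have hzap : ∀ p, z p = (p.1, p.2 + (c : ZMod M)) := by
    intro p; rw [hcdef]; exact arcZ_apply k M hk p
  have hznp : ∀ (n : ℤ) p, (z ^ n) p = (p.1, p.2 + (n : ZMod M) * (c : ZMod M)) := by
    intro n p
    induction n using Int.induction_on generalizing p with
    | zero => simp
    | succ n ih =>
      rw [zpow_add_one, Equiv.Perm.mul_apply, ih, hzap]
      ext <;> simp
      ring
    | pred n ih =>
      have : z⁻¹ p = (p.1, p.2 - c) := by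
        rw [Equiv.Perm.inv_eq_iff_eq, hzap]; simp
      rw [zpow_sub_one, Equiv.Perm.mul_apply, ih, this]
      ext <;> simp
      ring
  have hA1 : ∀ n : ℤ, arcA k M ^ n = 1 ↔ (n : ZMod k) = 0 := by
    intro n
    constructor
    · intro h
      have h2 := congrFun (congrArg Prod.fst (Equiv.congr_fun h (arcE k M 0, 0))) n
      rw [arcA_zpow] at h2
      simp only [arcE, sub_self, Equiv.Perm.one_apply, if_true] at h2
      by_contra hne
      rw [if_neg hne] at h2
      exact h1M h2
    · intro h
      ext p i
      · rw [arcA_zpow]; simp [h]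
      · rw [arcA_zpow]; simp
  refine arc_elem k m hk2 hm (Equiv.Perm ((ZMod k → ZMod M) × ZMod M))
    (arcA k M) (arcG k M hk2 0) z ?_ ?_ ?_ ?_ ?_ ?_
  · apply Nat.dvd_antisymm
    · rw [orderOf_dvd_iff_pow_eq_one, ← zpow_natCast, hA1]
      simp
    · have h := pow_orderOf_eq_one (arcA k M)
      rw [← zpow_natCast, hA1] at h
      rw [← ZMod.natCast_eq_zero_iff]
      exact_mod_cast h
  · ext p i
    · simp [arcG_apply]
    · have h10 : (1 : ZMod k) ≠ 0 := by
        have : Fact (1 < k) := ⟨by omega⟩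
        exact one_ne_zero
      simp [arcG_apply, arcE, h10]
  · rintro i ⟨j, hj⟩
    rw [hA1]
    have h2 := congrFun (congrArg Prod.fst (Equiv.congr_fun hj (0, 0))) 0
    simp only [Equiv.Perm.mul_apply, arcA_zpow, arcG_apply] at h2
    simp only [Pi.zero_apply, Pi.sub_apply, arcE, if_true, sub_zero, zero_sub, neg_eq_zero] at h2
    by_contra hne
    rw [if_neg hne] at h2
    simp at h2
  · have ha : arcA k M ∈ Subgroup.closure {arcA k M, arcG k M hk2 0} :=
      Subgroup.subset_closure (by simp)
    have hg : arcG k M hk2 0 ∈ Subgroup.closure {arcA k M, arcG k M hk2 0} :=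
      Subgroup.subset_closure (by simp)
    have hall : ∀ n : ℤ, arcG k M hk2 n ∈ Subgroup.closure {arcA k M, arcG k M hk2 0} := by
      intro n
      rw [arcG_conj]
      exact Subgroup.mul_mem _ (Subgroup.mul_mem _ (Subgroup.zpow_mem _ ha _) hg)
        (Subgroup.zpow_mem _ ha _)
    refine Subgroup.pow_mem _ (Subgroup.mul_mem _ (Subgroup.mul_mem _ hg ?_) ?_) 2
    · exact_mod_cast hall 2
    · exact_mod_cast hall 1
  · ext p i
    · simp [hzap, arcA]
    · simp [hzap, arcA]
  · intro n
    have hdvd : (m : ℤ) ∣ n ↔ (n : ZMod M) * (c : ZMod M) = 0 := by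
      have : (n : ZMod M) * (c : ZMod M) = ((c * n : ℤ) : ZMod M) := by push_cast; ring
      rw [this, ZMod.intCast_zmod_eq_zero_iff_dvd]
      have hM : (M : ℤ) = c * m := by simp [M]
      rw [hM]
      exact (mul_dvd_mul_iff_left (by omega)).symm
    rw [hdvd]
    constructor
    · rintro ⟨j, hj⟩
      have h2 := congrArg Prod.snd (Equiv.congr_fun hj (0, 0))
      simp only [arcA_zpow, hznp] at h2
      simpa using h2.symm
    · intro h
      have : z ^ n = 1 := by
        ext p i
        · rw [hznp]; simp
        · rw [hznp, h]; simp
      rw [this]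
      exact Subgroup.one_mem _

theorem arc_two (m : ℕ) (hm : 1 ≤ m) : ArcConcl 2 m := by
  have hord : ∀ n : ℕ, ∀ j : ℤ, (DihedralGroup.sr (0 : ZMod n)) ^ j = 1 ∨
      (DihedralGroup.sr (0 : ZMod n)) ^ j = DihedralGroup.sr 0 := by
    intro n j
    rcases Int.even_or_odd' j with ⟨i, rfl | rfl⟩
    · left
      rw [zpow_mul, zpow_two, DihedralGroup.sr_mul_self, one_zpow]
    · right
      rw [zpow_add_one, zpow_mul, zpow_two, DihedralGroup.sr_mul_self, one_zpow, one_mul]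
  have hgL : ∀ n : ℕ, 3 ≤ n → ∀ x ∈ Subgroup.zpowers (DihedralGroup.sr (0 : ZMod n)),
      DihedralGroup.sr 1 * x * DihedralGroup.sr 1 ∈
        Subgroup.zpowers (DihedralGroup.sr (0 : ZMod n)) → x = 1 := by
    rintro n hn _ ⟨j, rfl⟩ ⟨i, hi⟩
    simp only at hi ⊢
    rcases hord n j with h | h
    · exact h
    · exfalso
      rw [h] at hi
      rcases hord n i with h' | h' <;> rw [h'] at hi
      · rw [DihedralGroup.one_def] at hi
        simp only [DihedralGroup.sr_mul_sr, DihedralGroup.r_mul_sr] at hi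
        cases hi
      · simp only [DihedralGroup.sr_mul_sr, DihedralGroup.r_mul_sr, DihedralGroup.sr.injEq] at hi
        have : ((2 : ℕ) : ZMod n) = 0 := by push_cast; linear_combination -hi
        rw [ZMod.natCast_eq_zero_iff] at this
        have := Nat.le_of_dvd (by norm_num) this
        omega
  have hgen : ∀ n : ℕ, Subgroup.closure
      {DihedralGroup.sr (0 : ZMod n), DihedralGroup.sr 1} = ⊤ := by
    intro n
    rw [eq_top_iff]
    have h0 : DihedralGroup.sr (0 : ZMod n) ∈ Subgroup.closure
      {DihedralGroup.sr (0 : ZMod n), DihedralGroup.sr 1} := Subgroup.subset_closure (by simp)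
    have h1 : DihedralGroup.sr (1 : ZMod n) ∈ Subgroup.closure
      {DihedralGroup.sr (0 : ZMod n), DihedralGroup.sr 1} := Subgroup.subset_closure (by simp)
    have h2 := Subgroup.mul_mem _ h0 h1
    have hr : ∀ i : ZMod n, DihedralGroup.r i ∈ Subgroup.closure
      {DihedralGroup.sr (0 : ZMod n), DihedralGroup.sr 1} := by
      intro i
      obtain ⟨j, rfl⟩ := ZMod.intCast_surjective i
      have := Subgroup.zpow_mem _ h2 j
      simpa using this
    rintro (i | i) -
    · exact hr i
    · have := Subgroup.mul_mem _ h0 (hr i)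
      simpa using this
  rcases Nat.lt_or_ge m 3 with h | h
  · refine arc_elem 2 m le_rfl hm (DihedralGroup 4) (DihedralGroup.sr 0) (DihedralGroup.sr 1)
      (DihedralGroup.r 2 ^ (2 / m)) (by simp) (DihedralGroup.sr_mul_self 1) ?_ ?_ ?_ ?_
    · intro i hi
      exact hgL 4 (by norm_num) _ ⟨i, rfl⟩ hi
    · rw [hgen]; trivial
    · apply Commute.pow_right
      change _ * _ = _ * _
      decide
    · intro n
      have hm2 : ((2 / m : ℕ) : ℤ) * m = 2 := by
        interval_cases m <;> norm_num
      have hpos : ((2 / m : ℕ) : ℤ) ≠ 0 := by rintro h; rw [h] at hm2; norm_num at hm2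
      have h1 : (m : ℤ) ∣ n ↔ (2 : ℤ) ∣ (2 / m : ℕ) * n := by
        rw [← hm2]
        exact (mul_dvd_mul_iff_left hpos).symm
      rw [h1, ← zpow_natCast, ← zpow_mul]
      generalize ((2 / m : ℕ) : ℤ) * n = t
      have hr2 : (DihedralGroup.r (2 : ZMod 4)) * DihedralGroup.r 2 = 1 := by decide
      rcases Int.even_or_odd' t with ⟨i, rfl | rfl⟩
      · rw [zpow_mul, zpow_two, hr2, one_zpow]
        simp
      · rw [zpow_add_one, zpow_mul, zpow_two, hr2, one_zpow, one_mul]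
        constructor
        · rintro ⟨j, hj⟩
          exfalso
          simp only at hj
          rcases hord 4 j with h' | h' <;> rw [h'] at hj <;> revert hj <;> decide
        · intro h; omega
  · have : NeZero m := ⟨by omega⟩
    refine arc_coset 2 m le_rfl (DihedralGroup m) (Subgroup.zpowers (DihedralGroup.sr 0)) ⊤
      (DihedralGroup.sr 1) (DihedralGroup.sr_mul_self 1) (hgL m h) le_top ?_ ?_ ?_
    · rw [eq_top_iff, ← hgen m]
      apply Subgroup.closure_mono
      rintro x (rfl | rfl)
      · left; exact Subgroup.mem_zpowers _
      · right; rfl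
    · rw [Nat.card_zpowers, DihedralGroup.orderOf_sr]
    · rw [Subgroup.relIndex_top_right]
      have := Subgroup.card_mul_index (Subgroup.zpowers (DihedralGroup.sr (0 : ZMod m)))
      rw [Nat.card_zpowers, DihedralGroup.orderOf_sr, DihedralGroup.nat_card] at this
      omega

/-- For all integers `k ≥ 2` and `m ≥ 1`, there exist a finite connected
simple graph `Γ` which is regular of valency `k` and a group `G` of
automorphisms of `Γ` such that `G` is transitive on vertices, transitive on
ordered pairs of adjacent vertices, and admits a block of imprimitivity of
size `m`. -/
theorem exists_arc_transitive_graph (k m : ℕ) (hk : 2 ≤ k) (hm : 1 ≤ m) :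
    ∃ (V : Type) (_ : Fintype V) (Γ : SimpleGraph V)
      (G : Subgroup (Equiv.Perm V)),
      Γ.Connected ∧
      (∀ v : V, (Γ.neighborSet v).ncard = k) ∧
      (∀ σ ∈ G, ∀ u v : V, Γ.Adj u v ↔ Γ.Adj (σ u) (σ v)) ∧
      (∀ u v : V, ∃ σ ∈ G, σ u = v) ∧
      (∀ u v u' v' : V, Γ.Adj u v → Γ.Adj u' v' →
        ∃ σ ∈ G, σ u = u' ∧ σ v = v') ∧
      ∃ B : Set V, B.Nonempty ∧ B.ncard = m ∧
        ∀ σ ∈ G, σ '' B = B ∨ Disjoint (σ '' B) B := by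
  rcases Nat.lt_or_ge k 3 with h | h
  · obtain rfl : k = 2 := by omega
    exact arc_two m hm
  · exact arc_three k m h hm
end

section
/- There exists a unique automorphism b of H_k satisfying b(x_i) = x_{i+1}x_{n+1} for 1 ≤ i ≤ n−1, b(x_i) = x_{i+1} for n ≤ i ≤ 2n−1, and b(x_{2n}) = x_1^{−1}x_{n+1}^{−1}x_{n+2}^{−1}⋯x_{2n}^{−1}. This automorphism satisfies b(z) = z, and if k = 2n+1 is prime then b has order exactly k in Aut(H_k). -/
/-- The discrete Heisenberg group `H_k` (`k = 2n+1`), realized concretely on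
`(Fin n → ℤ) × (Fin n → ℤ) × ℤ`. -/
@[ext]
structure Heis (n : ℕ) where
  a : Fin n → ℤ
  b : Fin n → ℤ
  c : ℤ

namespace Heis

variable {n : ℕ}

instance : Mul (Heis n) :=
  ⟨fun g h => ⟨g.a + h.a, g.b + h.b, g.c + h.c + ∑ i, g.a i * h.b i⟩⟩

instance : One (Heis n) := ⟨⟨0, 0, 0⟩⟩

instance : Inv (Heis n) :=
  ⟨fun g => ⟨-g.a, -g.b, -g.c + ∑ i, g.a i * g.b i⟩⟩

@[simp] lemma mul_a (g h : Heis n) : (g * h).a = g.a + h.a := rfl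
@[simp] lemma mul_b (g h : Heis n) : (g * h).b = g.b + h.b := rfl
@[simp] lemma mul_c (g h : Heis n) :
    (g * h).c = g.c + h.c + ∑ i, g.a i * h.b i := rfl
@[simp] lemma one_a : (1 : Heis n).a = 0 := rfl
@[simp] lemma one_b : (1 : Heis n).b = 0 := rfl
@[simp] lemma one_c : (1 : Heis n).c = 0 := rfl
@[simp] lemma inv_a (g : Heis n) : g⁻¹.a = -g.a := rfl
@[simp] lemma inv_b (g : Heis n) : g⁻¹.b = -g.b := rfl
@[simp] lemma inv_c (g : Heis n) : g⁻¹.c = -g.c + ∑ i, g.a i * g.b i := rfl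

instance : Group (Heis n) where
  mul_assoc g h k := by
    ext <;> simp [Finset.sum_add_distrib, add_mul, mul_add] <;> ring
  one_mul g := by ext <;> simp
  mul_one g := by ext <;> simp
  inv_mul_cancel g := by
    ext <;> simp [Finset.sum_add_distrib, neg_mul] <;> ring

end Heis

/-- The generators `x_1, …, x_{2n}` of the Heisenberg group: for `1 ≤ i ≤ n`,
`x_i = (e_i, 0, 0)`; for `n+1 ≤ i ≤ 2n`, `x_i = (0, e_{i-n}, 0)`. -/
def xg (n : ℕ) (i : ℕ) : Heis n :=
  if h : 1 ≤ i ∧ i ≤ n then ⟨Pi.single (⟨i - 1, by omega⟩ : Fin n) 1, 0, 0⟩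
  else if h' : n + 1 ≤ i ∧ i ≤ 2 * n then
    ⟨0, Pi.single (⟨i - n - 1, by omega⟩ : Fin n) 1, 0⟩
  else 1

/-- The central element `z = (0,0,1)`. -/
def zz (n : ℕ) : Heis n := ⟨0, 0, 1⟩

/-- The automorphism `t : (a,b,c) ↦ (-a,-b,c)` of the Heisenberg group. -/
def tAut (n : ℕ) : MulAut (Heis n) where
  toFun g := ⟨-g.a, -g.b, g.c⟩
  invFun g := ⟨-g.a, -g.b, g.c⟩
  left_inv g := by ext <;> simp
  right_inv g := by ext <;> simp
  map_mul' g h := by ext <;> simp <;> ring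

/-- The subgroup `⟨t⟩` of `Aut(H_k)` generated by `t`. -/
abbrev tsub (n : ℕ) : Subgroup (MulAut (Heis n)) := Subgroup.zpowers (tAut n)

/-- The group `R_k = H_k ⋊ ⟨t⟩`. -/
abbrev RR (n : ℕ) := SemidirectProduct (Heis n) (tsub n) (tsub n).subtype

/-- The element `t` of `R_k`. -/
def tR (n : ℕ) : RR n := SemidirectProduct.inr ⟨tAut n, Subgroup.mem_zpowers _⟩

/-- The defining conditions for the automorphism `b` of `H_k`. -/
def IsB (n : ℕ) (b : MulAut (Heis n)) : Prop :=
  (∀ i : ℕ, 1 ≤ i → i ≤ n - 1 → b (xg n i) = xg n (i + 1) * xg n (n + 1)) ∧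
  (∀ i : ℕ, n ≤ i → i ≤ 2 * n - 1 → b (xg n i) = xg n (i + 1)) ∧
  b (xg n (2 * n)) =
    (xg n 1)⁻¹ * ((List.range n).map fun j => (xg n (n + 1 + j))⁻¹).prod

/-- The defining conditions for the automorphism `B` of `R_k` extending `b`. -/
def IsBR (n : ℕ) (b : MulAut (Heis n)) (B : MulAut (RR n)) : Prop :=
  (∀ h : Heis n, B (SemidirectProduct.inl h) = SemidirectProduct.inl (b h)) ∧
  B (tR n) = SemidirectProduct.inl (xg n (n + 1)) * tR n

namespace BProof

lemma xg_x {n : ℕ} (i : Fin n) : xg n (i + 1) = ⟨Pi.single i 1, 0, 0⟩ := by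
  have := i.2
  unfold xg
  rw [dif_pos ⟨by omega, by omega⟩]
  simp

lemma xg_y {n : ℕ} (i : Fin n) : xg n (n + 1 + i) = ⟨0, Pi.single i 1, 0⟩ := by
  have := i.2
  unfold xg
  rw [dif_neg (by omega), dif_pos ⟨by omega, by omega⟩]
  have : (⟨n + 1 + i - n - 1, by omega⟩ : Fin n) = i := by ext; simp; omega
  rw [this]

lemma ylist {n : ℕ} (l : ℕ) (hl : l ≤ n) :
    ((List.range l).map fun j => (xg n (n + 1 + j))⁻¹).prod
      = ⟨0, fun i => if (i : ℕ) < l then -1 else 0, 0⟩ := by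
  induction l with
  | zero => simp; rfl
  | succ l ih =>
    rw [List.range_succ, List.map_append, List.prod_append, ih (by omega)]
    have h := xg_y (⟨l, by omega⟩ : Fin n)
    simp only at h
    simp only [List.map_cons, List.map_nil, List.prod_cons, List.prod_nil, mul_one, h]
    ext i
    · simp
    · simp only [Heis.mul_b, Heis.inv_b, Pi.add_apply, Pi.neg_apply, Pi.single_apply, Fin.ext_iff]
      split_ifs <;> omega
    · simp

lemma gen {n : ℕ} (hn : 1 ≤ n) (S : Subgroup (Heis n))
    (h : ∀ i, 1 ≤ i → i ≤ 2 * n → xg n i ∈ S) (g : Heis n) : g ∈ S := by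
  have hx (i : Fin n) : (⟨Pi.single i 1, 0, 0⟩ : Heis n) ∈ S := by
    rw [← xg_x]; exact h _ (by omega) (by omega)
  have hy (i : Fin n) : (⟨0, Pi.single i 1, 0⟩ : Heis n) ∈ S := by
    rw [← xg_y]; exact h _ (by omega) (by omega)
  let SA : AddSubgroup (Fin n → ℤ) :=
    { carrier := {a | (⟨a, 0, 0⟩ : Heis n) ∈ S}
      zero_mem' := S.one_mem
      add_mem' := fun {u v} hu hv => by
        have := S.mul_mem hu hv
        change (⟨u + v, 0, 0⟩ : Heis n) ∈ S
        convert this using 1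
        ext <;> simp
      neg_mem' := fun {u} hu => by
        have := S.inv_mem hu
        change (⟨-u, 0, 0⟩ : Heis n) ∈ S
        convert this using 1
        ext <;> simp }
  let SB : AddSubgroup (Fin n → ℤ) :=
    { carrier := {a | (⟨0, a, 0⟩ : Heis n) ∈ S}
      zero_mem' := S.one_mem
      add_mem' := fun {u v} hu hv => by
        have := S.mul_mem hu hv
        change (⟨0, u + v, 0⟩ : Heis n) ∈ S
        convert this using 1
        ext <;> simp
      neg_mem' := fun {u} hu => by
        have := S.inv_mem hu
        change (⟨0, -u, 0⟩ : Heis n) ∈ S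
        convert this using 1
        ext <;> simp }
  let SC : AddSubgroup ℤ :=
    { carrier := {c | (⟨0, 0, c⟩ : Heis n) ∈ S}
      zero_mem' := S.one_mem
      add_mem' := fun {u v} hu hv => by
        have := S.mul_mem hu hv
        change (⟨0, 0, u + v⟩ : Heis n) ∈ S
        convert this using 1
        ext <;> simp
      neg_mem' := fun {u} hu => by
        have := S.inv_mem hu
        change (⟨0, 0, -u⟩ : Heis n) ∈ S
        convert this using 1
        ext <;> simp }
  have key (T : AddSubgroup (Fin n → ℤ)) (hT : ∀ i, Pi.single i 1 ∈ T) (a) : a ∈ T := by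
    have : a = ∑ i, a i • (Pi.single i 1 : Fin n → ℤ) := by
      ext j; simp [Finset.sum_apply, Pi.single_apply]
    rw [this]
    exact T.sum_mem fun i _ => T.zsmul_mem (hT i) _
  have hA : (⟨g.a, 0, 0⟩ : Heis n) ∈ S := key SA hx g.a
  have hB : (⟨0, g.b, 0⟩ : Heis n) ∈ S := key SB hy g.b
  have h1 : (1 : ℤ) ∈ SC := by
    let i : Fin n := ⟨0, hn⟩
    have := S.mul_mem (S.mul_mem (hx i) (hy i)) (S.mul_mem (S.inv_mem (hx i)) (S.inv_mem (hy i)))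
    change (⟨0, 0, 1⟩ : Heis n) ∈ S
    convert this using 1
    ext <;> simp [Pi.single_apply]
  have hC : (⟨0, 0, g.c⟩ : Heis n) ∈ S := by
    have := SC.zsmul_mem h1 g.c
    rw [smul_eq_mul, mul_one] at this
    exact this
  have := S.mul_mem (S.mul_mem hB hA) hC
  convert this using 1
  ext <;> simp

lemma ext_gen {n : ℕ} (hn : 1 ≤ n) (f g : MulAut (Heis n))
    (h : ∀ i, 1 ≤ i → i ≤ 2 * n → f (xg n i) = g (xg n i)) : f = g := by
  ext1 x
  exact gen hn (MonoidHom.eqLocus f.toMonoidHom g.toMonoidHom) h x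

lemma isB_unique {n : ℕ} (hn : 1 ≤ n) (f g : MulAut (Heis n)) (hf : IsB n f) (hg : IsB n g) :
    f = g := by
  apply ext_gen hn
  intro i h1 h2
  by_cases h3 : i ≤ n - 1
  · rw [hf.1 i h1 h3, hg.1 i h1 h3]
  by_cases h4 : i ≤ 2 * n - 1
  · rw [hf.2.1 i (by omega) h4, hg.2.1 i (by omega) h4]
  obtain rfl : i = 2 * n := by omega
  rw [hf.2.2, hg.2.2]

def T (m : ℤ) : ℤ := m * (m + 1) / 2

lemma T_two (m : ℤ) : 2 * T m = m * (m + 1) :=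
  Int.mul_ediv_cancel' (Int.even_mul_succ_self m).two_dvd

lemma T_add (m l : ℤ) : T (m + l) = T m + T l + m * l := by
  have h1 := T_two m
  have h2 := T_two l
  have h3 := T_two (m + l)
  have : 2 * T (m + l) = 2 * (T m + T l + m * l) := by linear_combination h3 - h1 - h2
  omega

/-- the explicit automorphism -/
def bb (m : ℕ) : MulAut (Heis (m + 1)) where
  toFun g := ⟨Fin.cons (-g.b (Fin.last m)) (Fin.init g.a),
    Fin.cons (∑ i, g.a i - g.b (Fin.last m)) (fun i => g.b i.castSucc - g.b (Fin.last m)),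
    g.c + T (g.b (Fin.last m)) - g.b (Fin.last m) * ∑ i, g.a i⟩
  invFun g := ⟨Fin.snoc (Fin.tail g.a) (g.b 0 - ∑ i, g.a i),
    Fin.snoc (fun i => g.b i.succ - g.a 0) (-g.a 0),
    g.c - T (-g.a 0) + (-g.a 0) * (g.b 0 - g.a 0)⟩
  left_inv g := by
    ext i
    · refine Fin.lastCases ?_ (fun j => ?_) i
      · simp only [Fin.snoc_last, Fin.cons_zero]
        rw [Fin.sum_univ_succ (Fin.cons _ _ : Fin (m + 1) → ℤ), Fin.sum_univ_castSucc g.a]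
        simp [Fin.init]; ring
      · simp [Fin.init, Fin.tail]
    · refine Fin.lastCases ?_ (fun j => ?_) i
      · simp
      · simp
    · simp; ring
  right_inv g := by
    ext i
    · refine Fin.cases ?_ (fun j => ?_) i
      · simp
      · simp [Fin.tail]
    · refine Fin.cases ?_ (fun j => ?_) i
      · simp [Fin.sum_univ_castSucc, Fin.tail, Fin.sum_univ_succ g.a]; ring
      · simp
    · simp [Fin.sum_univ_castSucc, Fin.tail, Fin.sum_univ_succ g.a]; ring
  map_mul' g h := by
    ext i
    · refine Fin.cases ?_ (fun j => ?_) i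
      · simp; ring
      · simp [Fin.init]
    · refine Fin.cases ?_ (fun j => ?_) i
      · simp [Finset.sum_add_distrib]; ring
      · simp; ring
    · simp only [Heis.mul_a, Heis.mul_b, Heis.mul_c, Pi.add_apply, T_add, Finset.sum_add_distrib]
      rw [Fin.sum_univ_succ (n := m) (f := fun i => (Fin.cons _ _ : Fin (m + 1) → ℤ) i * _)]
      simp only [Fin.cons_zero, Fin.cons_succ, Fin.init, mul_sub, Finset.sum_sub_distrib,
        ← Finset.sum_mul]
      rw [Fin.sum_univ_castSucc (fun i => g.a i * h.b i), Fin.sum_univ_castSucc g.a]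
      ring

lemma bb_apply (m : ℕ) (g : Heis (m + 1)) : bb m g =
  ⟨Fin.cons (-g.b (Fin.last m)) (Fin.init g.a),
    Fin.cons (∑ i, g.a i - g.b (Fin.last m)) (fun i => g.b i.castSucc - g.b (Fin.last m)),
    g.c + T (g.b (Fin.last m)) - g.b (Fin.last m) * ∑ i, g.a i⟩ := rfl

lemma T_zero : T 0 = 0 := rfl
lemma T_one : T 1 = 1 := rfl
lemma T_neg_one : T (-1) = 0 := rfl

lemma rel_prod (m : ℕ) : (xg (m + 1) 1)⁻¹ *
    ((List.range (m + 1)).map fun j => (xg (m + 1) (m + 1 + 1 + j))⁻¹).prod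
    = ⟨-Pi.single 0 1, fun _ => -1, 1⟩ := by
  rw [ylist _ le_rfl]
  simp only [Fin.is_lt, if_true]
  have h := xg_x (0 : Fin (m + 1))
  simp only [Fin.val_zero, zero_add] at h
  rw [h]
  ext i
  · simp
  · simp
  · simp [Pi.single_apply]

lemma isB_bb (m : ℕ) : IsB (m + 1) (bb m) := by
  refine ⟨fun i h1 h2 => ?_, fun i h1 h2 => ?_, ?_⟩
  · obtain ⟨j, rfl⟩ : ∃ j, i = j + 1 := ⟨i - 1, by omega⟩
    have e1 := xg_x (⟨j, by omega⟩ : Fin (m + 1))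
    have e2 := xg_x (⟨j + 1, by omega⟩ : Fin (m + 1))
    have e3 := xg_y (0 : Fin (m + 1))
    simp only [Fin.val_zero, add_zero] at e1 e2 e3
    rw [e1, e2, e3, bb_apply]
    ext i
    · refine Fin.cases ?_ (fun j => ?_) i
      · simp [Pi.single_apply, Fin.ext_iff]
      · simp [Fin.init, Pi.single_apply, Fin.ext_iff]
    · refine Fin.cases ?_ (fun j => ?_) i
      · simp
      · simp
    · have hne : (0 : Fin (m + 1)) ≠ ⟨j + 1, by omega⟩ := by simp [Fin.ext_iff]
      simp [T_zero, Pi.single_apply, hne]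
  · by_cases h3 : i = m + 1
    · subst h3
      have e1 := xg_x (Fin.last m)
      have e3 := xg_y (0 : Fin (m + 1))
      simp only [Fin.val_zero, add_zero, Fin.val_last] at e1 e3
      rw [e1, e3, bb_apply]
      ext i
      · refine Fin.cases ?_ (fun j => ?_) i
        · simp
        · simp [Fin.init]
      · refine Fin.cases ?_ (fun j => ?_) i
        · simp
        · simp
      · simp [T_zero]
    · obtain ⟨j, rfl⟩ : ∃ j, i = m + 1 + 1 + j := ⟨i - (m + 2), by omega⟩
      have e1 := xg_y (⟨j, by omega⟩ : Fin (m + 1))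
      have e2 := xg_y (⟨j + 1, by omega⟩ : Fin (m + 1))
      have hl : (Fin.last m) ≠ (⟨j, by omega⟩ : Fin (m + 1)) := by
        simp [Fin.ext_iff]; omega
      simp only at e1 e2
      rw [e1, add_assoc (m + 1 + 1) j 1, e2, bb_apply]
      ext i
      · refine Fin.cases ?_ (fun j => ?_) i
        · simp [hl]
        · simp [Fin.init]
      · refine Fin.cases ?_ (fun j => ?_) i
        · simp [hl, Pi.single_apply, Fin.ext_iff]
        · simp [hl]
          simp [Pi.single_apply, Fin.ext_iff]
      · simp [hl, T_zero]
  · rw [rel_prod]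
    have e1 := xg_y (Fin.last m)
    have : m + 1 + 1 + (Fin.last m : ℕ) = 2 * (m + 1) := by simp; omega
    rw [this] at e1
    rw [e1, bb_apply]
    ext i
    · refine Fin.cases ?_ (fun j => ?_) i
      · simp
      · simp [Fin.init]
    · refine Fin.cases ?_ (fun j => ?_) i
      · simp
      · simp
    · simp [T_one]

/-- differences of consecutive basis vectors -/
def dv (m j : ℕ) : Heis (m + 1) :=
  ⟨fun i => if (i : ℕ) = j then 1 else if (i : ℕ) = j + 1 then -1 else 0, 0, 0⟩

lemma bb_neg (m : ℕ) : bb m ⟨-Pi.single 0 1, fun _ => -1, 1⟩ = dv m 0 := by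
  rw [bb_apply, dv]
  ext i
  · refine Fin.cases ?_ (fun j => ?_) i
    · simp
    · simp only [Fin.cons_succ, Fin.init, Pi.neg_apply, Pi.single_apply, Fin.ext_iff]
      simp
      split_ifs <;> simp_all
  · refine Fin.cases ?_ (fun j => ?_) i
    · simp
    · simp
  · simp [T_neg_one]

lemma bb_dv (m j : ℕ) (h : j < m) : bb m (dv m j) = dv m (j + 1) := by
  rw [bb_apply, dv, dv]
  have hs : ∑ i : Fin (m + 1), (if (i : ℕ) = j then (1 : ℤ) else if (i : ℕ) = j + 1 then -1 else 0)
      = 0 := by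
    have : ∀ i : Fin (m + 1), (if (i : ℕ) = j then (1 : ℤ) else if (i : ℕ) = j + 1 then -1 else 0)
      = (if i = ⟨j, by omega⟩ then 1 else 0) - (if i = ⟨j + 1, by omega⟩ then 1 else 0) := by
      intro i
      simp only [Fin.ext_iff]
      split_ifs <;> omega
    simp [this]
  ext i
  · refine Fin.cases ?_ (fun j => ?_) i
    · simp
    · simp [Fin.init]
  · refine Fin.cases ?_ (fun j => ?_) i
    · simp only [hs]; simp
    · simp
  · simp [T_zero]

lemma dv_last (m : ℕ) : dv m m = xg (m + 1) (m + 1) := by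
  have e1 := xg_x (Fin.last m)
  simp only [Fin.val_last] at e1
  rw [e1, dv]
  ext i
  · have := i.2
    simp only [Pi.single_apply, Fin.ext_iff, Fin.val_last]
    split_ifs <;> omega
  · simp
  · simp

lemma pow_y (m : ℕ) : (bb m ^ (2 * (m + 1) + 1)) (xg (m + 1) (m + 1 + 1)) =
    xg (m + 1) (m + 1 + 1) := by
  have hb := isB_bb m
  have s1 : ∀ j ≤ m, (bb m ^ j) (xg (m + 1) (m + 1 + 1)) = xg (m + 1) (m + 1 + 1 + j) := by
    intro j
    induction j with
    | zero => simp
    | succ j ih =>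
      intro hj
      rw [pow_succ', MulAut.mul_apply, ih (by omega), hb.2.1 _ (by omega) (by omega)]
      rfl
  have s2 : (bb m ^ (m + 2)) (xg (m + 1) (m + 1 + 1)) = dv m 0 := by
    rw [pow_succ', pow_succ', MulAut.mul_apply, MulAut.mul_apply, s1 m le_rfl,
      show m + 1 + 1 + m = 2 * (m + 1) by ring, hb.2.2, rel_prod, bb_neg]
  have s3 : ∀ j ≤ m, (bb m ^ (m + 2 + j)) (xg (m + 1) (m + 1 + 1)) = dv m j := by
    intro j
    induction j with
    | zero => intro _; exact s2
    | succ j ih =>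
      intro hj
      rw [← add_assoc, pow_succ', MulAut.mul_apply, ih (by omega), bb_dv _ _ (by omega)]
  rw [show 2 * (m + 1) + 1 = m + 2 + m + 1 by ring, pow_succ', MulAut.mul_apply, s3 m le_rfl,
    dv_last, hb.2.1 _ (by omega) (by omega)]

lemma pow_k (m : ℕ) : bb m ^ (2 * (m + 1) + 1) = 1 := by
  have hb := isB_bb m
  set K := 2 * (m + 1) + 1 with hK
  let S : Subgroup (Heis (m + 1)) :=
    MonoidHom.eqLocus (bb m ^ K).toMonoidHom (MonoidHom.id _)
  have memS (g) : g ∈ S ↔ (bb m ^ K) g = g := Iff.rfl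
  have inv (g) : bb m g ∈ S ↔ g ∈ S := by
    rw [memS, memS, ← MulAut.mul_apply, ← pow_succ, pow_succ', MulAut.mul_apply]
    exact (bb m).injective.eq_iff
  have hy0 : xg (m + 1) (m + 1 + 1) ∈ S := pow_y m
  have hy : ∀ j ≤ m, xg (m + 1) (m + 1 + 1 + j) ∈ S := by
    intro j
    induction j with
    | zero => intro _; exact hy0
    | succ j ih =>
      intro hj
      rw [← add_assoc, ← hb.2.1 _ (by omega) (by omega), inv]
      exact ih (by omega)
  have hx : ∀ j ≤ m, xg (m + 1) (m + 1 - j) ∈ S := by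
    intro j
    induction j with
    | zero =>
      intro _
      rw [← inv, hb.2.1 _ (by omega) (by omega)]
      exact hy0
    | succ j ih =>
      intro hj
      rw [← inv, hb.1 _ (by omega) (by omega)]
      refine S.mul_mem ?_ hy0
      rw [show m + 1 - (j + 1) + 1 = m + 1 - j by omega]
      exact ih (by omega)
  ext1 g
  refine gen (by omega) S (fun i h1 h2 => ?_) g
  by_cases h : i ≤ m + 1
  · have := hx (m + 1 - i) (by omega)
    rwa [show m + 1 - (m + 1 - i) = i by omega] at this
  · have := hy (i - (m + 2)) (by omega)
    rwa [show m + 1 + 1 + (i - (m + 2)) = i by omega] at this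

lemma bb_zz (m : ℕ) : bb m (zz (m + 1)) = zz (m + 1) := by
  rw [bb_apply, zz]
  ext i
  · refine Fin.cases ?_ (fun j => ?_) i
    · simp
    · simp [Fin.init]
  · refine Fin.cases ?_ (fun j => ?_) i
    · simp
    · simp
  · simp [T_zero]

lemma bb_ne (m : ℕ) : bb m ≠ 1 := by
  intro h
  have h1 := (isB_bb m).2.1 (m + 1) le_rfl (by omega)
  have e1 := xg_x (Fin.last m)
  have e3 := xg_y (0 : Fin (m + 1))
  simp only [Fin.val_zero, add_zero, Fin.val_last] at e1 e3
  rw [h, MulAut.one_apply, e1, e3] at h1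
  have := congrFun (congrArg Heis.a h1) (Fin.last m)
  simp at this

end BProof

/-- There is a unique automorphism `b` of `H_k` with `b(x_i) = x_{i+1}x_{n+1}`
for `1 ≤ i ≤ n-1`, `b(x_i) = x_{i+1}` for `n ≤ i ≤ 2n-1`, and
`b(x_{2n}) = x_1⁻¹ x_{n+1}⁻¹ ⋯ x_{2n}⁻¹`; it satisfies `b(z) = z`, and if
`k = 2n+1` is prime then `b` has order exactly `k` in `Aut(H_k)`. -/
theorem b_automorphism (n k : ℕ) (hn : 1 ≤ n) (hk : k = 2 * n + 1) :
    (∃! b : MulAut (Heis n), IsB n b) ∧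
    ∀ b : MulAut (Heis n), IsB n b →
      b (zz n) = zz n ∧ (Nat.Prime k → orderOf b = k) := by
  obtain ⟨m, rfl⟩ : ∃ m, n = m + 1 := ⟨n - 1, by omega⟩
  refine ⟨⟨BProof.bb m, BProof.isB_bb m, fun f hf =>
    BProof.isB_unique hn f _ hf (BProof.isB_bb m)⟩, fun b hb => ?_⟩
  obtain rfl : b = BProof.bb m := BProof.isB_unique hn b _ hb (BProof.isB_bb m)
  refine ⟨BProof.bb_zz m, fun hp => ?_⟩
  haveI : Fact k.Prime := ⟨hp⟩
  subst hk
  exact orderOf_eq_prime (BProof.pow_k m) (BProof.bb_ne m)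
end

section
/- Assume k = 2n+1 is prime. There exists a unique automorphism B of R_k whose restriction to H_k equals b and which satisfies B(t) = x_{n+1}·t, and this automorphism B has order exactly k in Aut(R_k). -/
lemma xg_lo (n i : ℕ) (h : i < n) : xg n (i+1) = ⟨Pi.single (⟨i, h⟩ : Fin n) 1, 0, 0⟩ := by
  unfold xg
  rw [dif_pos (by omega)]
  rfl

lemma xg_hi (n i : ℕ) (h : i < n) : xg n (n+1+i) = ⟨0, Pi.single (⟨i, h⟩ : Fin n) 1, 0⟩ := by
  unfold xg
  rw [dif_neg (by omega), dif_pos (by omega)]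
  congr 2
  ext1
  simp only []
  omega

lemma xg_comm (n i j : ℕ) (h1 : j ≠ i + n) (h2 : i ≠ j + n) : xg n i * xg n j = xg n j * xg n i := by
  have key : ∀ i : ℕ, (∃ l, ∃ h : l < n, i = l+1 ∧ xg n i = ⟨Pi.single (⟨l, h⟩ : Fin n) 1, 0, 0⟩) ∨
      (∃ l, ∃ h : l < n, i = n+1+l ∧ xg n i = ⟨0, Pi.single (⟨l, h⟩ : Fin n) 1, 0⟩) ∨ xg n i = 1 := by
    intro i
    by_cases hi : 1 ≤ i ∧ i ≤ n
    · left
      obtain ⟨l, rfl⟩ : ∃ l, i = l+1 := ⟨i-1, by omega⟩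
      exact ⟨l, by omega, rfl, xg_lo _ _ _⟩
    · by_cases hi' : n+1 ≤ i ∧ i ≤ 2*n
      · right; left
        obtain ⟨l, rfl⟩ : ∃ l, i = n+1+l := ⟨i-(n+1), by omega⟩
        exact ⟨l, by omega, rfl, xg_hi _ _ _⟩
      · right; right
        unfold xg
        rw [dif_neg hi, dif_neg hi']
  rcases key i with ⟨l, hl, e, h⟩ | ⟨l, hl, e, h⟩ | h <;>
  rcases key j with ⟨m, hm, e', h'⟩ | ⟨m, hm, e', h'⟩ | h' <;> rw [h, h']
  · ext <;> simp [add_comm]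
  · have : l ≠ m := by omega
    ext <;> simp [Pi.single_apply, this, this.symm]
  · simp
  · have : l ≠ m := by omega
    ext <;> simp [Pi.single_apply, this, this.symm]
  · ext <;> simp [add_comm]
  all_goals simp

lemma xg_gen (n : ℕ) (S : Subgroup (Heis n)) (hS : ∀ i, 1 ≤ i → i ≤ 2*n → xg n i ∈ S)
    (hn : 1 ≤ n) (g : Heis n) : g ∈ S := by
  have hA : ∀ a : Fin n → ℤ, (⟨a, 0, 0⟩ : Heis n) ∈ S := by
    let T : AddSubgroup (Fin n → ℤ) :=
      { carrier := {a | (⟨a, 0, 0⟩ : Heis n) ∈ S}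
        zero_mem' := S.one_mem
        add_mem' := by
          intro a b ha hb
          have := S.mul_mem ha hb
          change _ ∈ S
          convert this using 1
          ext <;> simp
        neg_mem' := by
          intro a ha
          have := S.inv_mem ha
          change _ ∈ S
          convert this using 1
          ext <;> simp }
    intro a
    change a ∈ T
    rw [pi_eq_sum_univ' a]
    refine sum_mem fun i _ => ?_
    have h1 : (Pi.single i 1 : Fin n → ℤ) ∈ T := by
      change _ ∈ S
      have := hS (i+1) (by omega) (by omega)
      rwa [xg_lo n i i.2] at this
    convert T.zsmul_mem h1 (a i) using 1
  have hB : ∀ a : Fin n → ℤ, (⟨0, a, 0⟩ : Heis n) ∈ S := by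
    let T : AddSubgroup (Fin n → ℤ) :=
      { carrier := {a | (⟨0, a, 0⟩ : Heis n) ∈ S}
        zero_mem' := S.one_mem
        add_mem' := by
          intro a b ha hb
          have := S.mul_mem ha hb
          change _ ∈ S
          convert this using 1
          ext <;> simp
        neg_mem' := by
          intro a ha
          have := S.inv_mem ha
          change _ ∈ S
          convert this using 1
          ext <;> simp }
    intro a
    change a ∈ T
    rw [pi_eq_sum_univ' a]
    refine sum_mem fun i _ => ?_
    have h1 : (Pi.single i 1 : Fin n → ℤ) ∈ T := by
      change _ ∈ S
      have := hS (n+1+i) (by omega) (by omega)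
      rwa [xg_hi n i i.2] at this
    convert T.zsmul_mem h1 (a i) using 1
  have hC : (⟨0, 0, g.c⟩ : Heis n) ∈ S := by
    have := S.mul_mem (S.mul_mem (hB (Pi.single ⟨0, hn⟩ (-g.c))) (hA (Pi.single ⟨0, hn⟩ 1)))
      (S.mul_mem (hB (Pi.single ⟨0, hn⟩ (g.c))) (hA (Pi.single ⟨0, hn⟩ (-1))))
    convert this using 1
    ext j
    · simp [Pi.single_apply]; split_ifs <;> simp
    · simp [Pi.single_apply]; split_ifs <;> simp
    · simp [Pi.single_apply]
  have := S.mul_mem (S.mul_mem (hB g.b) (hA g.a)) hC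
  convert this using 1
  ext <;> simp

lemma tAut_sq (n : ℕ) : tAut n * tAut n = 1 := by
  ext g <;> simp [tAut]

lemma tsub_cases (n : ℕ) (s : tsub n) : s = 1 ∨ s = ⟨tAut n, Subgroup.mem_zpowers _⟩ := by
  obtain ⟨s, m, rfl⟩ := s
  rcases Int.even_or_odd' m with ⟨c, rfl | rfl⟩
  · left
    ext1
    simp only [zpow_mul]
    rw [show tAut n ^ (2:ℤ) = 1 by rw [zpow_two, tAut_sq]]
    simp
  · right
    ext1
    simp only [zpow_mul, zpow_add]
    rw [show tAut n ^ (2:ℤ) = 1 by rw [zpow_two, tAut_sq]]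
    simp

lemma tR_sq (n : ℕ) : tR n * tR n = 1 := by
  unfold tR
  rw [← map_mul]
  have : ((⟨tAut n, Subgroup.mem_zpowers _⟩ : tsub n) * ⟨tAut n, Subgroup.mem_zpowers _⟩) = 1 :=
    Subtype.ext (tAut_sq n)
  rw [this, map_one]

lemma tR_conj (n : ℕ) (g : Heis n) :
    tR n * SemidirectProduct.inl g = SemidirectProduct.inl (tAut n g) * tR n := by
  ext1 <;> simp [tR]

lemma RR_ext (n : ℕ) (E F : RR n →* RR n)
    (h1 : ∀ g, E (SemidirectProduct.inl g) = F (SemidirectProduct.inl g))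
    (h2 : E (tR n) = F (tR n)) : E = F := by
  apply SemidirectProduct.hom_ext
  · ext1 g; exact h1 g
  · ext1 s
    rcases tsub_cases n s with rfl | rfl
    · simp
    · exact h2

def Lp (n j : ℕ) : Heis n := ((List.range j).map fun j => (xg n (n + 1 + j))⁻¹).prod

lemma Lp_succ (n j : ℕ) : Lp n (j+1) = Lp n j * (xg n (n+1+j))⁻¹ := by
  simp [Lp, List.range_succ]

def Mp (n j : ℕ) : Heis n := ((List.range j).map fun j => (xg n (n + 1 + (j+1)))⁻¹).prod

lemma Mp_succ (n j : ℕ) : Mp n (j+1) = Mp n j * (xg n (n+1+(j+1)))⁻¹ := by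
  simp [Mp, List.range_succ]

lemma Lp_Mp (n j : ℕ) : Lp n (j+1) = (xg n (n+1))⁻¹ * Mp n j := by
  induction j with
  | zero => simp [Lp, Mp]
  | succ j ih => rw [Lp_succ, ih, Mp_succ, mul_assoc]

lemma Mp_comm (n j : ℕ) (hn : 1 ≤ n) : Commute (xg n 1) (Mp n j) := by
  induction j with
  | zero => simp [Mp]
  | succ j ih =>
    rw [Mp_succ]
    exact ih.mul_right (Commute.inv_right (xg_comm n _ _ (by omega) (by omega)))

lemma Mp_comm' (n j : ℕ) (hn : j + 1 ≤ n) : Commute (xg n (n+1)) (Mp n j) := by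
  induction j with
  | zero => simp [Mp]
  | succ j ih =>
    rw [Mp_succ]
    exact (ih (by omega)).mul_right (Commute.inv_right (xg_comm n _ _ (by omega) (by omega)))

lemma tAut_xg (n i : ℕ) : tAut n (xg n i) = (xg n i)⁻¹ := by
  unfold xg
  split_ifs <;> ext <;> simp [tAut]

lemma tAut_Lp (n j : ℕ) (hn : 1 ≤ n) : tAut n (Lp n j) = (Lp n j)⁻¹ := by
  have hc : ∀ j m, Commute (Lp n j) (xg n (n+1+m)) := by
    intro j m
    induction j with
    | zero => simp [Lp]
    | succ j ih =>
      rw [Lp_succ]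
      by_cases h : m = j
      · subst h
        exact ih.mul_left (Commute.refl _).inv_left
      by_cases h' : n + 1 + m = n+1+j + n ∨ n+1+j = n+1+m+n
      · rcases h' with h' | h'
        · have : xg n (n+1+m) = 1 := by
            unfold xg; rw [dif_neg (by omega), dif_neg (by omega)]
          rw [this]; exact Commute.one_right _
        · have : xg n (n+1+j) = 1 := by
            unfold xg; rw [dif_neg (by omega), dif_neg (by omega)]
          rw [this]; simpa using ih
      · exact ih.mul_left (Commute.inv_left (xg_comm n _ _ (by omega) (by omega)))
  induction j with
  | zero => simp [Lp]
  | succ j ih =>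
    rw [Lp_succ, map_mul, ih, map_inv, tAut_xg, mul_inv_rev]
    exact (hc j j).inv_inv.inv_right.eq.trans (by simp) |>.trans rfl

section
variable {n : ℕ} (hn : 1 ≤ n) {b : MulAut (Heis n)} (hb : IsB n b)
include hn hb

lemma b_last : b (xg n (2*n)) = (xg n 1)⁻¹ * Lp n n := hb.2.2

lemma b_Lp (j : ℕ) (hj : j + 1 ≤ n) : b (Lp n j) = Mp n j := by
  induction j with
  | zero => simp [Lp, Mp]
  | succ j ih =>
    rw [Lp_succ, Mp_succ, map_mul, ih (by omega), map_inv,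
      hb.2.1 (n+1+j) (by omega) (by omega)]
    rfl

lemma u_lo (j : ℕ) (hj : j < n) : b^[j] (xg n (n+1)) = xg n (n+1+j) := by
  induction j with
  | zero => rfl
  | succ j ih =>
    rw [Function.iterate_succ_apply', ih (by omega), hb.2.1 _ (by omega) (by omega)]
    rfl

lemma u_mid : b^[n] (xg n (n+1)) = (xg n 1)⁻¹ * Lp n n := by
  obtain ⟨m, rfl⟩ : ∃ m, n = m+1 := ⟨n-1, by omega⟩
  rw [Function.iterate_succ_apply', u_lo hn hb m (by omega), ← b_last hn hb]
  congr 2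
  omega

lemma b_mid : b ((xg n 1)⁻¹ * Lp n n) = (b (xg n 1))⁻¹ * xg n (n+1) * xg n 1 := by
  have h : b (Lp n n) = xg n (n+1) * xg n 1 := by
    obtain ⟨m, rfl⟩ : ∃ m, n = m+1 := ⟨n-1, by omega⟩
    have e : xg (m+1) (m+1+1+m) = xg (m+1) (2*(m+1)) := by congr 1; omega
    rw [Lp_succ, map_mul, b_Lp hn hb m le_rfl, map_inv, e, b_last hn hb, Lp_Mp]
    group
  rw [map_mul, h, map_inv, mul_assoc]

lemma u_hi (j : ℕ) (hj : j + 2 ≤ n) :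
    b^[n+1+j] (xg n (n+1)) = (xg n (j+2))⁻¹ * xg n (j+1) := by
  induction j with
  | zero =>
    rw [add_zero, Function.iterate_succ_apply', u_mid hn hb, b_mid hn hb,
      hb.1 1 le_rfl (by omega), xg_comm n (1+1) (n+1) (by omega) (by omega)]
    group
  | succ j ih =>
    rw [← add_assoc, Function.iterate_succ_apply', ih (by omega), map_mul, map_inv,
      hb.1 (j+1) (by omega) (by omega)]
    by_cases h : j + 2 ≤ n - 1
    · rw [hb.1 (j+2) (by omega) h, xg_comm n (j+1+1) (n+1) (by omega) (by omega),
        xg_comm n (j+2+1) (n+1) (by omega) (by omega)]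
      group
    · omega

lemma u_last : b^[2*n] (xg n (n+1)) = xg n n := by
  by_cases h : n = 1
  · subst h
    rw [show 2 * 1 = 1 + 1 by rfl, Function.iterate_succ_apply', u_mid hn hb, b_mid hn hb,
      hb.2.1 1 le_rfl (by omega)]
    group
  · obtain ⟨m, rfl⟩ : ∃ m, n = m+2 := ⟨n-2, by omega⟩
    rw [show 2 * (m+2) = (m+2+1+m) + 1 by omega, Function.iterate_succ_apply',
      u_hi hn hb m le_rfl, map_mul, map_inv, hb.2.1 (m+2) le_rfl (by omega),
      hb.1 (m+1) (by omega) (by omega), xg_comm _ (m+1+1) _ (by omega) (by omega)]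
    group

lemma u_per : b^[2*n+1] (xg n (n+1)) = xg n (n+1) := by
  rw [Function.iterate_succ_apply', u_last hn hb, hb.2.1 n le_rfl (by omega)]

lemma b_per (g : Heis n) : b^[2*n+1] g = g := by
  let S : Subgroup (Heis n) :=
    { carrier := {g | b^[2*n+1] g = g}
      one_mem' := by simp [iterate_map_one]
      mul_mem' := by
        intro x y hx hy
        simp only [Set.mem_ofPred_eq] at *
        rw [iterate_map_mul, hx, hy]
      inv_mem' := by
        intro x hx
        simp only [Set.mem_ofPred_eq] at *
        rw [iterate_map_inv, hx] }
  have hu : ∀ j, b^[j] (xg n (n+1)) ∈ S := by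
    intro j
    change b^[2*n+1] _ = _
    rw [← Function.iterate_add_apply, add_comm, Function.iterate_add_apply, u_per hn hb]
  have hlo : ∀ j, j < n → xg n (n - j) ∈ S := by
    intro j hj
    induction j with
    | zero => have := hu (2*n); rwa [u_last hn hb] at this
    | succ j ih =>
      have h1 := hu (n+1+(n-(j+2)))
      rw [u_hi hn hb _ (by omega), show n - (j+2) + 2 = n - j by omega,
        show n - (j+2) + 1 = n - (j+1) by omega] at h1
      simpa using S.mul_mem (ih (by omega)) h1
  refine xg_gen n S ?_ hn g
  intro i h1 h2
  by_cases h : i ≤ n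
  · have := hlo (n - i) (by omega)
    rwa [show n - (n - i) = i by omega] at this
  · have := hu (i - (n+1))
    rwa [u_lo hn hb _ (by omega), show n + 1 + (i - (n+1)) = i by omega] at this

lemma b_compat (g : Heis n) :
    xg n (n+1) * tAut n (b g) * (xg n (n+1))⁻¹ = b (tAut n g) := by
  have : g ∈ ((MulAut.conj (xg n (n+1))).toMonoidHom.comp
      ((tAut n).toMonoidHom.comp b.toMonoidHom)).eqLocus (b.toMonoidHom.comp (tAut n).toMonoidHom) := by
    refine xg_gen n _ ?_ hn g
    intro i h1 h2
    change xg n (n+1) * tAut n (b (xg n i)) * (xg n (n+1))⁻¹ = b (tAut n (xg n i))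
    rw [tAut_xg, map_inv]
    by_cases hi : i ≤ n - 1
    · have h3 : Commute (xg n (n+1)) (xg n (i+1)) := xg_comm n _ _ (by omega) (by omega)
      rw [hb.1 i h1 hi, map_mul, tAut_xg, tAut_xg, ← mul_assoc, h3.inv_right.eq, mul_inv_rev,
        h3.inv_inv.eq]
      group
    by_cases hi' : i ≤ 2*n-1
    · rw [hb.2.1 i (by omega) hi', tAut_xg]
      have h3 : Commute (xg n (n+1)) (xg n (i+1)) := xg_comm n _ _ (by omega) (by omega)
      rw [h3.inv_right.eq]; group
    · obtain rfl : i = 2*n := by omega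
      rw [b_last hn hb, map_mul, map_inv, tAut_xg, tAut_Lp n n hn]
      obtain ⟨m, rfl⟩ : ∃ m, n = m+1 := ⟨n-1, by omega⟩
      rw [Lp_Mp]
      have h3 := (Mp_comm (m+1) m hn).inv_right.eq
      have h4 := (Mp_comm' (m+1) m le_rfl).inv_right.eq
      simp only [mul_inv_rev, inv_inv, mul_assoc, mul_inv_cancel, mul_one]
      rw [h3, ← mul_assoc, h4, mul_assoc]
  exact this

lemma E_per (E : RR n →* RR n)
    (h1 : ∀ g, E (SemidirectProduct.inl g) = SemidirectProduct.inl (b g))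
    (h2 : E (tR n) = SemidirectProduct.inl (xg n (n+1)) * tR n) (r : RR n) :
    E^[2*n+1] r = r := by
  have hi : ∀ j g, E^[j] (SemidirectProduct.inl g) = SemidirectProduct.inl (b^[j] g) := by
    intro j
    induction j with
    | zero => intro g; rfl
    | succ j ih => intro g; rw [Function.iterate_succ_apply, h1, ih]; rfl
  have hs : ∀ j (N u : Heis n), b^[j] (xg n (n+1)) = u →
      E^[j] (tR n) = SemidirectProduct.inl N * tR n →
      E^[j+1] (tR n) = SemidirectProduct.inl (u * N) * tR n := by
    intro j N u hu h
    rw [Function.iterate_succ_apply, h2, iterate_map_mul, hi, hu, h, map_mul, mul_assoc]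
  have ha : ∀ j, j ≤ n → E^[j] (tR n) = SemidirectProduct.inl (Lp n j)⁻¹ * tR n := by
    intro j hj
    induction j with
    | zero => simp [Lp]
    | succ j ih =>
      rw [hs j _ _ (u_lo hn hb j hj) (ih (by omega)), Lp_succ]
      simp
  have hc : ∀ j, j + 1 ≤ n → E^[n+1+j] (tR n) = SemidirectProduct.inl (xg n (j+1))⁻¹ * tR n := by
    intro j hj
    induction j with
    | zero =>
      rw [add_zero, hs n _ _ (u_mid hn hb) (ha n le_rfl)]
      congr 2
      group
    | succ j ih =>
      rw [← add_assoc, hs (n+1+j) _ _ (u_hi hn hb j (by omega)) (ih (by omega))]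
      congr 2
      group
  have hd : E^[2*n+1] (tR n) = tR n := by
    have := hc (n-1) (by omega)
    rw [show n + 1 + (n-1) = 2*n by omega, show n - 1 + 1 = n by omega] at this
    rw [hs _ _ _ (u_last hn hb) this]
    simp
  let F : RR n →* RR n :=
    { toFun := E^[2*n+1], map_one' := iterate_map_one E _, map_mul' := iterate_map_mul E _ }
  have : F = MonoidHom.id _ := by
    apply RR_ext
    · intro g
      change E^[2*n+1] _ = _
      rw [hi, b_per hn hb]; rfl
    · exact hd
  exact DFunLike.congr_fun this r

lemma E_exists : ∃ E : RR n →* RR n,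
    (∀ g, E (SemidirectProduct.inl g) = SemidirectProduct.inl (b g)) ∧
    E (tR n) = SemidirectProduct.inl (xg n (n+1)) * tR n := by
  classical
  have hne : (⟨tAut n, Subgroup.mem_zpowers _⟩ : tsub n) ≠ 1 := by
    intro h
    have h' : tAut n = 1 := congrArg Subtype.val h
    have := congrArg (fun f : MulAut (Heis n) => (f (xg n 1)).a ⟨0, hn⟩) h'
    have e := xg_lo n 0 hn
    simp only [zero_add] at e
    simp [e, tAut] at this
  have htt : ((⟨tAut n, Subgroup.mem_zpowers _⟩ : tsub n) * ⟨tAut n, Subgroup.mem_zpowers _⟩) = 1 :=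
    Subtype.ext (tAut_sq n)
  have hsq : (SemidirectProduct.inl (xg n (n+1)) * tR n) *
      (SemidirectProduct.inl (xg n (n+1)) * tR n) = 1 := by
    rw [mul_assoc, ← mul_assoc (tR n), tR_conj, tAut_xg, mul_assoc, tR_sq]
    simp
  let f : tsub n →* RR n :=
    { toFun := fun s => if s = 1 then 1 else SemidirectProduct.inl (xg n (n+1)) * tR n
      map_one' := by simp
      map_mul' := by
        intro s s'
        rcases tsub_cases n s with rfl | rfl <;> rcases tsub_cases n s' with rfl | rfl
        · simp
        · simp
        · simp
        · rw [htt, if_neg hne, hsq, if_pos rfl] }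
  have hf : f ⟨tAut n, Subgroup.mem_zpowers _⟩ = SemidirectProduct.inl (xg n (n+1)) * tR n :=
    if_neg hne
  refine ⟨SemidirectProduct.lift (SemidirectProduct.inl.comp b.toMonoidHom) f ?_, ?_, ?_⟩
  · intro s
    ext1 g
    rcases tsub_cases n s with rfl | rfl
    · change SemidirectProduct.inl (b g) = f 1 * SemidirectProduct.inl (b g) * (f 1)⁻¹
      rw [map_one]; simp
    · change SemidirectProduct.inl (b (tAut n g)) =
        f ⟨tAut n, Subgroup.mem_zpowers _⟩ * SemidirectProduct.inl (b g) *
          (f ⟨tAut n, Subgroup.mem_zpowers _⟩)⁻¹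
      rw [hf]
      change SemidirectProduct.inl (b (tAut n g)) = _ * SemidirectProduct.inl (b g) * _
      rw [eq_mul_inv_iff_mul_eq, ← b_compat hn hb g, mul_assoc _ (tR n), tR_conj]
      simp only [← mul_assoc, ← map_mul]
      simp
  · intro g
    simp
  · refine Eq.trans ?_ hf
    exact SemidirectProduct.lift_inr _ _ _ _

end

/-- Assume `k = 2n+1` is prime. There is a unique automorphism `B` of
`R_k = H_k ⋊ ⟨t⟩` restricting to `b` on `H_k` with `B(t) = x_{n+1}·t`, and this
automorphism has order exactly `k` in `Aut(R_k)`. -/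
theorem B_automorphism (n k : ℕ) (hn : 1 ≤ n) (hk : k = 2 * n + 1)
    (hp : Nat.Prime k) (b : MulAut (Heis n)) (hb : IsB n b) :
    (∃! B : MulAut (RR n), IsBR n b B) ∧
    ∀ B : MulAut (RR n), IsBR n b B → orderOf B = k := by
  constructor
  · obtain ⟨E, h1, h2⟩ := E_exists hn hb
    have hE := E_per hn hb E h1 h2
    have bij : Function.Bijective E := by
      constructor
      · intro x y h
        rw [← hE x, ← hE y, Function.iterate_succ_apply, h, Function.iterate_succ_apply]
      · intro x
        exact ⟨E^[2*n] x, by rw [← Function.iterate_succ_apply' E]; exact hE x⟩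
    refine ⟨MulEquiv.ofBijective E bij, ⟨h1, h2⟩, ?_⟩
    rintro B ⟨h3, h4⟩
    have := RR_ext n B.toMonoidHom E (fun g => (h3 g).trans (h1 g).symm) (h4.trans h2.symm)
    ext1 r
    exact DFunLike.congr_fun this r
  · rintro B ⟨h1, h2⟩
    haveI := Fact.mk hp
    apply orderOf_eq_prime
    · ext1 r
      have := E_per hn hb B.toMonoidHom h1 h2 r
      have h : ∀ m, (B^m) r = B^[m] r := by
        intro m
        induction m with
        | zero => rfl
        | succ m ih => rw [pow_succ', Function.iterate_succ_apply', ← ih]; rfl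
      rw [h, hk]
      exact this
    · rintro rfl
      have h3 : (SemidirectProduct.inl (xg n (n+1)) : RR n) = 1 := by simpa using h2
      have h4 : xg n (n+1) = 1 := SemidirectProduct.inl_injective (by rw [h3, map_one])
      have e := xg_hi n 0 hn
      rw [add_zero, h4] at e
      have := congrArg (fun g : Heis n => g.b ⟨0, hn⟩) e
      simp at this
end

section
/- For every integer m ≥ 1, one has b(x_{2n}^m) = x_1^{−m}·x_{n+1}^{−m}·x_{n+2}^{−m}·⋯·x_{2n}^{−m}·z^{−m(m−1)/2} in H_k. Consequently, if m is odd, then the subgroup N_k generated by x_1^m, …, x_{2n}^m, z^m satisfies b(N_k) = N_k. -/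
/-- The generating set `{x_1^m, …, x_{2n}^m, z^m}` of the subgroup `N_k`. -/
def Ngen (n m : ℕ) : Set (Heis n) :=
  {g | (∃ i : ℕ, 1 ≤ i ∧ i ≤ 2 * n ∧ g = xg n i ^ m) ∨ g = zz n ^ m}

/-- The subgroup `N_k = ⟨x_1^m, …, x_{2n}^m, z^m⟩` of `H_k`. -/
def Nsub (n m : ℕ) : Subgroup (Heis n) := Subgroup.closure (Ngen n m)


lemma Heis.pow_eq {n : ℕ} (g : Heis n) (m : ℕ) :
    g ^ m = ⟨(m : ℤ) • g.a, (m : ℤ) • g.b, m * g.c + (m.choose 2 : ℤ) * ∑ i, g.a i * g.b i⟩ := by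
  induction m with
  | zero => ext <;> simp
  | succ k ih =>
    rw [pow_succ, ih]
    ext
    · simp; ring
    · simp; ring
    · have h : (k + 1).choose 2 = k + k.choose 2 := by
        rw [Nat.choose_succ_succ' k 1]; simp
      simp only [Heis.mul_c, h, Pi.smul_apply, smul_eq_mul, mul_assoc, ← Finset.mul_sum]
      push_cast
      ring

lemma xg_low (n : ℕ) (i : ℕ) (h1 : 1 ≤ i) (h2 : i ≤ n) :
    xg n i = ⟨Pi.single (⟨i - 1, by omega⟩ : Fin n) 1, 0, 0⟩ := by
  unfold xg
  rw [dif_pos ⟨h1, h2⟩]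

lemma xg_high (n : ℕ) (j : ℕ) (h : j < n) :
    xg n (n + 1 + j) = ⟨0, Pi.single (⟨j, h⟩ : Fin n) 1, 0⟩ := by
  unfold xg
  rw [dif_neg (by omega), dif_pos (by omega)]
  have e : n + 1 + j - n - 1 = j := by omega
  simp [e]

lemma prod_high (n m : ℕ) (k : ℕ) (hk : k ≤ n) :
    ((List.range k).map fun j => (xg n (n + 1 + j) ^ m)⁻¹).prod =
      ⟨0, fun i => if i.1 < k then -(m : ℤ) else 0, 0⟩ := by
  induction k with
  | zero => ext <;> simp
  | succ k ih =>
    rw [List.range_succ, List.map_append, List.prod_append, ih (by omega)]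
    simp only [List.map_cons, List.map_nil, List.prod_cons, List.prod_nil, mul_one]
    rw [xg_high n k (by omega), Heis.pow_eq]
    ext i
    · simp
    · simp only [Heis.mul_b, Heis.inv_b, Pi.add_apply, Pi.neg_apply, Pi.smul_apply, Pi.single_apply,
        Fin.ext_iff, smul_eq_mul]
      split_ifs <;> first | omega | simp
    · simp

lemma bpow_formula (n m : ℕ) (hn : 1 ≤ n)
    (b : MulAut (Heis n)) (hb : IsB n b) :
    b (xg n (2 * n) ^ m) =
      (xg n 1 ^ m)⁻¹ *
        ((List.range n).map fun j => (xg n (n + 1 + j) ^ m)⁻¹).prod *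
        (zz n ^ (m * (m - 1) / 2))⁻¹ := by
  have h1 := prod_high n 1 n le_rfl
  simp only [pow_one] at h1
  rw [map_pow, hb.2.2, h1, prod_high n m n le_rfl, xg_low n 1 le_rfl hn, ← Nat.choose_two_right]
  simp only [Heis.pow_eq, zz]
  have h2 : (m : ℤ) * m = m + 2 * (m.choose 2 : ℤ) := by
    have := Nat.triangle_succ m
    have h3 : m * m = m + 2 * m.choose 2 := by
      clear * -
      induction m with
      | zero => simp
      | succ k ih =>
        have h : (k + 1).choose 2 = k + k.choose 2 := by
          rw [Nat.choose_succ_succ' k 1]; simp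
        rw [h]; nlinarith
    exact_mod_cast h3
  ext i
  · simp
  · simp
  · simp [Pi.single_apply]
    linarith

lemma b_zz (n : ℕ) (hn : 1 ≤ n) (b : MulAut (Heis n)) (hb : IsB n b) : b (zz n) = zz n := by
  have e2 : xg n (2 * n) = ⟨0, Pi.single (⟨n - 1, by omega⟩ : Fin n) 1, 0⟩ := by
    rw [← xg_high n (n - 1) (by omega)]
    congr 1; omega
  have hz : xg n n * xg n (2 * n) = xg n (2 * n) * xg n n * zz n := by
    rw [e2, xg_low n n hn le_rfl]
    ext <;> simp [zz]
    simp [Pi.single_apply]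
  have h1 := prod_high n 1 n le_rfl
  simp only [pow_one] at h1
  have h := congrArg b hz
  rw [map_mul, map_mul, map_mul, hb.2.1 n le_rfl (by omega), hb.2.2, h1] at h
  rw [← mul_right_inj, ← h, xg_low n 1 le_rfl hn, xg_high n 0 (by omega)]
  ext <;> simp [zz, Pi.single_apply]
  ring

/-- For every `m ≥ 1`,
`b(x_{2n}^m) = x_1^{-m} · x_{n+1}^{-m} · ⋯ · x_{2n}^{-m} · z^{-m(m-1)/2}`.
Consequently, if `m` is odd then `b(N_k) = N_k`. -/
theorem b_x2n_pow (n m : ℕ) (hn : 1 ≤ n) (hm : 1 ≤ m)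
    (b : MulAut (Heis n)) (hb : IsB n b) :
    b (xg n (2 * n) ^ m) =
      (xg n 1 ^ m)⁻¹ *
        ((List.range n).map fun j => (xg n (n + 1 + j) ^ m)⁻¹).prod *
        (zz n ^ (m * (m - 1) / 2))⁻¹ ∧
    (Odd m → Subgroup.map b.toMonoidHom (Nsub n m) = Nsub n m) := by
  refine ⟨bpow_formula n m hn b hb, fun hodd => ?_⟩
  have hz := b_zz n hn b hb
  have hf := bpow_formula n m hn b hb
  have hdiv : m * (m - 1) / 2 = m * ((m - 1) / 2) := by
    obtain ⟨r, rfl⟩ := hodd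
    rw [Nat.mul_div_assoc]
    simp
  rw [hdiv, pow_mul] at hf
  have hlow : ∀ i : ℕ, 1 ≤ i → i ≤ n - 1 →
      b (xg n i ^ m) = xg n (i + 1) ^ m * xg n (n + 1) ^ m := by
    intro i h1 h2
    rw [map_pow, hb.1 i h1 h2]
    refine Commute.mul_pow ?_ m
    have e := xg_high n 0 (by omega)
    rw [add_zero] at e
    rw [e, xg_low n (i + 1) (by omega) (by omega)]
    have : i ≠ 0 := by omega
    refine Heis.ext ?_ ?_ ?_ <;> simp [Pi.single_apply, Fin.ext_iff]
    refine Finset.sum_eq_zero fun x _ => ?_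
    split_ifs <;> first | rfl | omega
  have hmid : ∀ i : ℕ, n ≤ i → i ≤ 2 * n - 1 → b (xg n i ^ m) = xg n (i + 1) ^ m := by
    intro i h1 h2
    rw [map_pow, hb.2.1 i h1 h2]
  have gx : ∀ i : ℕ, 1 ≤ i → i ≤ 2 * n → xg n i ^ m ∈ Nsub n m := fun i h1 h2 =>
    Subgroup.subset_closure (Or.inl ⟨i, h1, h2, rfl⟩)
  have gz : zz n ^ m ∈ Nsub n m := Subgroup.subset_closure (Or.inr rfl)
  have hprod : ∀ K : Subgroup (Heis n), (∀ j, j < n → xg n (n + 1 + j) ^ m ∈ K) →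
      ((List.range n).map fun j => (xg n (n + 1 + j) ^ m)⁻¹).prod ∈ K := by
    intro K hK
    apply Subgroup.list_prod_mem
    intro x hx
    simp only [List.mem_map, List.mem_range] at hx
    obtain ⟨j, hj, rfl⟩ := hx
    exact K.inv_mem (hK j hj)
  apply le_antisymm
  · rw [Subgroup.map_le_iff_le_comap]
    conv_lhs => unfold Nsub
    rw [Subgroup.closure_le]
    rintro g (⟨i, h1, h2, rfl⟩ | rfl)
    · change b (xg n i ^ m) ∈ Nsub n m
      rcases Nat.lt_or_ge i n with h | h
      · rw [hlow i h1 (by omega)]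
        exact mul_mem (gx _ (by omega) (by omega)) (gx _ (by omega) (by omega))
      · rcases Nat.lt_or_ge i (2 * n) with h' | h'
        · rw [hmid i h (by omega)]
          exact gx _ (by omega) (by omega)
        · obtain rfl : i = 2 * n := by omega
          rw [hf]
          exact mul_mem (mul_mem (inv_mem (gx _ (by omega) (by omega)))
            (hprod _ fun j hj => gx _ (by omega) (by omega))) (inv_mem (pow_mem gz _))
    · change b (zz n ^ m) ∈ Nsub n m
      rw [map_pow, hz]
      exact gz
  · have mb : ∀ g ∈ Nsub n m, b g ∈ Subgroup.map b.toMonoidHom (Nsub n m) := fun g hg =>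
      Subgroup.mem_map_of_mem b.toMonoidHom hg
    have kz : zz n ^ m ∈ Subgroup.map b.toMonoidHom (Nsub n m) := by
      have := mb _ gz
      rwa [map_pow, hz] at this
    have khigh : ∀ j, j < n →
        xg n (n + 1 + j) ^ m ∈ Subgroup.map b.toMonoidHom (Nsub n m) := by
      intro j hj
      have := mb _ (gx (n + j) (by omega) (by omega))
      rw [hmid _ (by omega) (by omega)] at this
      rwa [show n + 1 + j = n + j + 1 by omega]
    conv_lhs => unfold Nsub
    rw [Subgroup.closure_le]
    rintro g (⟨i, h1, h2, rfl⟩ | rfl)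
    · rcases Nat.lt_or_ge n i with h | h
      · have := khigh (i - (n + 1)) (by omega)
        rwa [show n + 1 + (i - (n + 1)) = i by omega] at this
      · rcases Nat.lt_or_ge 1 i with h' | h'
        · have h3 := mb _ (gx (i - 1) (by omega) (by omega))
          rw [hlow _ (by omega) (by omega), show i - 1 + 1 = i by omega] at h3
          exact (Subgroup.mul_mem_cancel_right _ (khigh 0 (by omega))).1 h3
        · obtain rfl : i = 1 := by omega
          have h3 := mb _ (gx (2 * n) (by omega) (by omega))
          rw [hf, Subgroup.mul_mem_cancel_right _ (inv_mem (pow_mem kz _)),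
            Subgroup.mul_mem_cancel_right _ (hprod _ khigh)] at h3
          exact inv_mem_iff.1 h3
    · exact kz
end

section
/- For every integer m ≥ 1, in the quotient group H_k/N_k: the image Z̄ of the subgroup ⟨z⟩ is a central cyclic subgroup of order m, the quotient (H_k/N_k)/Z̄ is isomorphic to (ℤ/mℤ)^{2n}, and consequently H_k/N_k has order m^k = m^{2n+1}. -/
namespace Heis

variable {n : ℕ}

/-- First coordinate subgroup scaled into a subgroup. -/
def preA (N : Subgroup (Heis n)) (m : ℕ) : AddSubgroup (Fin n → ℤ) where
  carrier := {u | (⟨(m : ℤ) • u, 0, 0⟩ : Heis n) ∈ N}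
  zero_mem' := by
    have : (⟨(m : ℤ) • (0 : Fin n → ℤ), 0, 0⟩ : Heis n) = 1 := by ext <;> simp
    simp only [Set.mem_setOf_eq, this, N.one_mem]
  add_mem' := by
    intro u v hu hv
    have : (⟨(m : ℤ) • (u + v), 0, 0⟩ : Heis n)
        = ⟨(m : ℤ) • u, 0, 0⟩ * ⟨(m : ℤ) • v, 0, 0⟩ := by
      ext <;> simp [mul_add]
    simp only [Set.mem_setOf_eq, this]
    exact N.mul_mem hu hv
  neg_mem' := by
    intro u hu
    have : (⟨(m : ℤ) • (-u), 0, 0⟩ : Heis n) = (⟨(m : ℤ) • u, 0, 0⟩)⁻¹ := by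
      ext <;> simp
    simp only [Set.mem_setOf_eq, this]
    exact N.inv_mem hu

/-- Second coordinate subgroup scaled into a subgroup. -/
def preB (N : Subgroup (Heis n)) (m : ℕ) : AddSubgroup (Fin n → ℤ) where
  carrier := {u | (⟨0, (m : ℤ) • u, 0⟩ : Heis n) ∈ N}
  zero_mem' := by
    have : (⟨0, (m : ℤ) • (0 : Fin n → ℤ), 0⟩ : Heis n) = 1 := by ext <;> simp
    simp only [Set.mem_setOf_eq, this, N.one_mem]
  add_mem' := by
    intro u v hu hv
    have : (⟨0, (m : ℤ) • (u + v), 0⟩ : Heis n)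
        = ⟨0, (m : ℤ) • u, 0⟩ * ⟨0, (m : ℤ) • v, 0⟩ := by
      ext <;> simp [mul_add]
    simp only [Set.mem_setOf_eq, this]
    exact N.mul_mem hu hv
  neg_mem' := by
    intro u hu
    have : (⟨0, (m : ℤ) • (-u), 0⟩ : Heis n) = (⟨0, (m : ℤ) • u, 0⟩)⁻¹ := by
      ext <;> simp
    simp only [Set.mem_setOf_eq, this]
    exact N.inv_mem hu

lemma eq_top_of_single (S : AddSubgroup (Fin n → ℤ))
    (h : ∀ i, (Pi.single i 1 : Fin n → ℤ) ∈ S) (u : Fin n → ℤ) : u ∈ S := by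
  have : u = ∑ i, u i • (Pi.single i 1 : Fin n → ℤ) := by
    ext j
    simp [Finset.sum_apply, Pi.single_apply]
  rw [this]
  exact S.sum_mem fun i _ => S.zsmul_mem (h i) _

lemma powA (u : Fin n → ℤ) (m : ℕ) :
    (⟨u, 0, 0⟩ : Heis n) ^ m = ⟨(m : ℤ) • u, 0, 0⟩ := by
  induction m with
  | zero => ext <;> simp
  | succ k ih => rw [pow_succ, ih]; ext <;> simp; ring

lemma powB (u : Fin n → ℤ) (m : ℕ) :
    (⟨0, u, 0⟩ : Heis n) ^ m = ⟨0, (m : ℤ) • u, 0⟩ := by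
  induction m with
  | zero => ext <;> simp
  | succ k ih => rw [pow_succ, ih]; ext <;> simp; ring

lemma powZ (m : ℕ) : zz n ^ m = ⟨0, 0, (m : ℤ)⟩ := by
  induction m with
  | zero => ext <;> simp
  | succ k ih => rw [pow_succ, ih]; ext <;> simp [zz]

lemma zpowZ (j : ℤ) : zz n ^ j = ⟨0, 0, j⟩ := by
  obtain ⟨k, rfl | rfl⟩ := j.eq_nat_or_neg
  · rw [zpow_natCast, powZ]
  · rw [zpow_neg, zpow_natCast, powZ]; ext <;> simp

/-- The congruence subgroup. -/
def cong (n m : ℕ) : Subgroup (Heis n) where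
  carrier := {g | (∀ i, (m : ℤ) ∣ g.a i) ∧ (∀ i, (m : ℤ) ∣ g.b i) ∧ (m : ℤ) ∣ g.c}
  one_mem' := by simp
  mul_mem' := by
    rintro g h ⟨h1, h2, h3⟩ ⟨h4, h5, h6⟩
    refine ⟨fun i => dvd_add (h1 i) (h4 i), fun i => dvd_add (h2 i) (h5 i), ?_⟩
    exact dvd_add (dvd_add h3 h6) (Finset.dvd_sum fun i _ => Dvd.dvd.mul_right (h1 i) _)
  inv_mem' := by
    rintro g ⟨h1, h2, h3⟩
    refine ⟨fun i => (dvd_neg.2 (h1 i)), fun i => (dvd_neg.2 (h2 i)), ?_⟩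
    exact dvd_add (dvd_neg.2 h3) (Finset.dvd_sum fun i _ => Dvd.dvd.mul_right (h1 i) _)

lemma xgA (i : Fin n) : xg n (i + 1) = ⟨Pi.single i 1, 0, 0⟩ := by
  have : 1 ≤ (i : ℕ) + 1 ∧ (i : ℕ) + 1 ≤ n := by omega
  rw [xg, dif_pos this]
  rfl

lemma xgB (i : Fin n) : xg n (n + 1 + i) = ⟨0, Pi.single i 1, 0⟩ := by
  have h1 : ¬ (1 ≤ n + 1 + (i : ℕ) ∧ n + 1 + (i : ℕ) ≤ n) := by omega
  have h2 : n + 1 ≤ n + 1 + (i : ℕ) ∧ n + 1 + (i : ℕ) ≤ 2 * n := by omega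
  have h3 : (⟨n + 1 + (i : ℕ) - n - 1, by omega⟩ : Fin n) = i := by ext; simp; omega
  rw [xg, dif_neg h1, dif_pos h2, h3]

lemma Nsub_eq (m : ℕ) : Nsub n m = cong n m := by
  apply le_antisymm
  · rw [Nsub, Subgroup.closure_le]
    rintro g (⟨i, h1, h2, rfl⟩ | rfl)
    · rcases le_or_gt i n with h | h
      · have := xgA (⟨i - 1, by omega⟩ : Fin n)
        simp only [Nat.sub_add_cancel h1] at this
        rw [this, powA]
        simp [cong]
      · have := xgB (⟨i - n - 1, by omega⟩ : Fin n)
        simp only [show n + 1 + (i - n - 1) = i by omega] at this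
        rw [this, powB]
        simp [cong]
    · rw [powZ]
      simp [cong]
  · rintro g ⟨h1, h2, h3⟩
    choose u hu using h1
    choose v hv using h2
    obtain ⟨w, hw⟩ := h3
    have e : g = ⟨0, (m : ℤ) • v, 0⟩ * ⟨(m : ℤ) • u, 0, 0⟩ * (zz n ^ m) ^ w := by
      rw [← zpow_natCast, ← zpow_mul, zpowZ]
      ext <;> simp [hu, hv, hw]
    rw [e]
    refine mul_mem (mul_mem ?_ ?_) (zpow_mem ?_ _)
    · refine eq_top_of_single (preB (Nsub n m) m) (fun i => ?_) v
      change _ ∈ Nsub n m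
      rw [← powB, ← xgB]
      exact Subgroup.subset_closure (Or.inl ⟨_, by omega, by omega, rfl⟩)
    · refine eq_top_of_single (preA (Nsub n m) m) (fun i => ?_) u
      change _ ∈ Nsub n m
      rw [← powA, ← xgA]
      exact Subgroup.subset_closure (Or.inl ⟨_, by omega, by omega, rfl⟩)
    · exact Subgroup.subset_closure (Or.inr rfl)

/-- Reduction of the first two coordinates modulo `m`. -/
def red (n m : ℕ) : Heis n →* Multiplicative (Fin (2 * n) → ZMod m) where
  toFun g := Multiplicative.ofAdd fun i =>
    if h : (i : ℕ) < n then ((g.a ⟨i, h⟩ : ℤ) : ZMod m)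
    else ((g.b ⟨i - n, by omega⟩ : ℤ) : ZMod m)
  map_one' := by
    rw [← ofAdd_zero]
    congr 1
    ext i
    simp
  map_mul' g h := by
    rw [← ofAdd_add]
    congr 1
    ext i
    by_cases hi : (i : ℕ) < n <;> simp [hi]

lemma red_surj (m : ℕ) : Function.Surjective (red n m) := by
  intro y
  refine ⟨⟨fun i => (Multiplicative.toAdd y ⟨i, by omega⟩).cast,
    fun i => (Multiplicative.toAdd y ⟨n + i, by omega⟩).cast, 0⟩, ?_⟩
  apply Multiplicative.toAdd.injective
  ext i
  by_cases hi : (i : ℕ) < n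
  · simp [red, hi]
  · have : n + ((i : ℕ) - n) = i := by omega
    simp [red, hi, this]

lemma red_eq_one (m : ℕ) (g : Heis n) :
    red n m g = 1 ↔ (∀ i, (m : ℤ) ∣ g.a i) ∧ (∀ i, (m : ℤ) ∣ g.b i) := by
  rw [← Multiplicative.toAdd.injective.eq_iff]
  simp only [funext_iff, ← ZMod.intCast_zmod_eq_zero_iff_dvd _ m]
  constructor
  · intro h
    constructor
    · intro i
      have := h ⟨i, by omega⟩
      simpa [red] using this
    · intro i
      have := h ⟨n + i, by omega⟩
      simpa [red] using this
  · rintro ⟨h1, h2⟩ i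
    by_cases hi : (i : ℕ) < n
    · simp [red, hi, h1]
    · simp [red, hi, h2]

lemma zz_comm (g : Heis n) (j : ℤ) : g * zz n ^ j = zz n ^ j * g := by
  rw [zpowZ]
  ext <;> simp [add_comm]

end Heis

/-- For `m ≥ 1`, in the quotient `H_k/N_k`: the image `Z̄` of `⟨z⟩` is a
central cyclic subgroup of order `m`, the quotient `(H_k/N_k)/Z̄` is isomorphic
to `(ℤ/mℤ)^{2n}` (stated via a surjective homomorphism with kernel `Z̄`), and
consequently `H_k/N_k` has order `m^k = m^{2n+1}`. -/
theorem quotient_Nsub_properties (n m k : ℕ) (hn : 1 ≤ n) (hk : k = 2 * n + 1)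
    (hm : 1 ≤ m) (N : Subgroup (Heis n)) (hN : N = Nsub n m) [N.Normal]
    (Z : Subgroup (Heis n ⧸ N))
    (hZ : Z = Subgroup.map (QuotientGroup.mk' N) (Subgroup.zpowers (zz n))) :
    Z ≤ Subgroup.center (Heis n ⧸ N) ∧
    IsCyclic Z ∧
    Nat.card Z = m ∧
    (∃ f : (Heis n ⧸ N) →* Multiplicative (Fin (2 * n) → ZMod m),
      Function.Surjective f ∧ f.ker = Z) ∧
    Nat.card (Heis n ⧸ N) = m ^ k := by
  have : NeZero m := ⟨by omega⟩
  have hmem : ∀ g : Heis n, g ∈ N ↔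
      (∀ i, (m : ℤ) ∣ g.a i) ∧ (∀ i, (m : ℤ) ∣ g.b i) ∧ (m : ℤ) ∣ g.c := by
    intro g
    rw [hN, Heis.Nsub_eq]
    rfl
  have hZ' : Z = Subgroup.zpowers (QuotientGroup.mk' N (zz n)) := by
    rw [hZ, MonoidHom.map_zpowers]
  have hcard : Nat.card Z = m := by
    rw [hZ', Nat.card_zpowers]
    have key : ∀ j : ℕ, (QuotientGroup.mk' N (zz n)) ^ j = 1 ↔ m ∣ j := by
      intro j
      rw [← map_pow, QuotientGroup.mk'_apply, QuotientGroup.eq_one_iff, hmem, Heis.powZ]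
      simp [Int.natCast_dvd_natCast]
    apply Nat.dvd_antisymm
    · rw [orderOf_dvd_iff_pow_eq_one, key]
    · rw [← key, pow_orderOf_eq_one]
  have hf : ∃ f : (Heis n ⧸ N) →* Multiplicative (Fin (2 * n) → ZMod m),
      Function.Surjective f ∧ f.ker = Z := by
    refine ⟨QuotientGroup.lift N (Heis.red n m) ?_, ?_, ?_⟩
    · intro g hg
      have := (hmem g).1 hg
      exact (Heis.red_eq_one m g).2 ⟨this.1, this.2.1⟩
    · intro y
      obtain ⟨g, rfl⟩ := Heis.red_surj m y
      exact ⟨QuotientGroup.mk g, rfl⟩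
    · ext q
      obtain ⟨g, rfl⟩ := QuotientGroup.mk'_surjective N q
      rw [MonoidHom.mem_ker, hZ', Subgroup.mem_zpowers_iff]
      simp only [QuotientGroup.mk'_apply, ← QuotientGroup.mk_zpow]
      change Heis.red n m g = 1 ↔ _
      rw [Heis.red_eq_one]
      constructor
      · rintro ⟨h1, h2⟩
        refine ⟨g.c, ?_⟩
        rw [QuotientGroup.eq, hmem, Heis.zpowZ]
        simpa using ⟨h1, h2⟩
      · rintro ⟨j, hj⟩
        rw [QuotientGroup.eq, hmem, Heis.zpowZ] at hj
        simp at hj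
        exact ⟨hj.1, hj.2.1⟩
  refine ⟨?_, ?_, hcard, hf, ?_⟩
  · rw [hZ']
    intro q hq
    obtain ⟨j, rfl⟩ := Subgroup.mem_zpowers_iff.1 hq
    rw [Subgroup.mem_center_iff]
    intro y
    obtain ⟨g, rfl⟩ := QuotientGroup.mk'_surjective N y
    rw [← map_zpow, ← map_mul, ← map_mul, Heis.zz_comm]
  · rw [hZ']
    infer_instance
  · obtain ⟨f, hs, hk'⟩ := hf
    rw [Subgroup.card_eq_card_quotient_mul_card_subgroup f.ker,
      Nat.card_congr (QuotientGroup.quotientKerEquivOfSurjective f hs).toEquiv, hk', hcard,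
      Nat.card_congr Multiplicative.toAdd, hk, pow_succ]
    simp [Nat.card_eq_fintype_card, ZMod.card]
end

section
/- Let m be an odd prime. Then the quotient group H_k/N_k is an extraspecial group of order m^k; that is, its center has order m, its center equals its commutator subgroup, and the quotient of H_k/N_k by its center is elementary abelian, isomorphic to (ℤ/mℤ)^{2n}. -/
open scoped commutatorElement

lemma Heis.powA_s12 {n : ℕ} (v : Fin n → ℤ) (m : ℕ) :
    (⟨v, 0, 0⟩ : Heis n) ^ m = ⟨(m : ℤ) • v, 0, 0⟩ := by
  induction m with
  | zero => ext <;> simp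
  | succ k ih => rw [pow_succ, ih]; ext <;> simp <;> ring

lemma Heis.powB_s12 {n : ℕ} (v : Fin n → ℤ) (m : ℕ) :
    (⟨0, v, 0⟩ : Heis n) ^ m = ⟨0, (m : ℤ) • v, 0⟩ := by
  induction m with
  | zero => ext <;> simp
  | succ k ih => rw [pow_succ, ih]; ext <;> simp <;> ring

lemma Heis.powC {n : ℕ} (m : ℕ) :
    (zz n) ^ m = ⟨0, 0, m⟩ := by
  induction m with
  | zero => ext <;> simp
  | succ k ih => rw [pow_succ, ih]; ext <;> simp [zz]

lemma Heis.zpowC {n : ℕ} (c d : ℤ) :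
    (⟨0, 0, c⟩ : Heis n) ^ d = ⟨0, 0, d * c⟩ := by
  let f : Multiplicative ℤ →* Heis n :=
    { toFun := fun d => ⟨0, 0, d.toAdd * c⟩
      map_one' := by ext <;> simp
      map_mul' := fun x y => by ext <;> simp [add_mul] }
  have h1 : (⟨0, 0, c⟩ : Heis n) = f (Multiplicative.ofAdd 1) := by
    ext <;> simp [f]
  rw [h1, ← map_zpow]
  ext <;> simp [f]

/-- The explicit congruence subgroup. -/
def Ncong (n m : ℕ) : Subgroup (Heis n) where
  carrier := {g | (∀ i, (m : ℤ) ∣ g.a i) ∧ (∀ i, (m : ℤ) ∣ g.b i) ∧ (m : ℤ) ∣ g.c}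
  one_mem' := by simp
  mul_mem' := by
    rintro x y ⟨h1, h2, h3⟩ ⟨h4, h5, h6⟩
    refine ⟨fun i => ?_, fun i => ?_, ?_⟩
    · simpa using dvd_add (h1 i) (h4 i)
    · simpa using dvd_add (h2 i) (h5 i)
    · exact dvd_add (dvd_add h3 h6) (Finset.dvd_sum fun i _ => (h1 i).mul_right _)
  inv_mem' := by
    rintro x ⟨h1, h2, h3⟩
    refine ⟨fun i => ?_, fun i => ?_, ?_⟩
    · simpa using (h1 i)
    · simpa using (h2 i)
    · exact dvd_add ((dvd_neg).2 h3) (Finset.dvd_sum fun i _ => (h1 i).mul_right _)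

lemma xg_fst {n : ℕ} (i : Fin n) : xg n (i + 1) = ⟨Pi.single i 1, 0, 0⟩ := by
  have : 1 ≤ (i : ℕ) + 1 ∧ (i : ℕ) + 1 ≤ n := ⟨by omega, by omega⟩
  simp [xg]

lemma xg_snd {n : ℕ} (i : Fin n) : xg n (n + i + 1) = ⟨0, Pi.single i 1, 0⟩ := by
  have h1 : ¬ (1 ≤ n + (i : ℕ) + 1 ∧ n + (i : ℕ) + 1 ≤ n) := by omega
  have h2 : (n + 1 ≤ n + (i : ℕ) + 1 ∧ n + (i : ℕ) + 1 ≤ 2 * n) := by omega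
  have h3 : (⟨n + (i : ℕ) + 1 - n - 1, by omega⟩ : Fin n) = i := by ext; simp; omega
  rw [xg, dif_neg h1, dif_pos h2, h3]

lemma Nsub_eq_Ncong (n m : ℕ) : Nsub n m = Ncong n m := by
  apply le_antisymm
  · rw [Nsub, Subgroup.closure_le]
    rintro g (⟨i, h1, h2, rfl⟩ | rfl)
    · unfold xg
      split_ifs with h h'
      · rw [Heis.powA_s12]; exact ⟨fun i => by simp, fun i => by simp, by simp⟩
      · rw [Heis.powB_s12]; exact ⟨fun i => by simp, fun i => by simp, by simp⟩
      · rw [one_pow]; exact one_mem _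
    · rw [Heis.powC]; exact ⟨fun i => by simp, fun i => by simp, by simp⟩
  · rintro ⟨a, b, c⟩ ⟨h1, h2, h3⟩
    simp only at h1 h2 h3
    choose a' ha using h1
    choose b' hb using h2
    obtain ⟨c', rfl⟩ := h3
    have hA : ∀ v : Fin n → ℤ, (⟨(m : ℤ) • v, 0, 0⟩ : Heis n) ∈ Nsub n m := by
      let S : AddSubgroup (Fin n → ℤ) :=
        { carrier := {v | (⟨(m : ℤ) • v, 0, 0⟩ : Heis n) ∈ Nsub n m}
          zero_mem' := by
            have : (⟨(m : ℤ) • 0, 0, 0⟩ : Heis n) = 1 := by ext <;> simp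
            simp only [Set.mem_ofPred_eq, this, one_mem]
          add_mem' := by
            intro x y hx hy
            change (⟨(m : ℤ) • x, 0, 0⟩ : Heis n) ∈ Nsub n m at hx
            change (⟨(m : ℤ) • y, 0, 0⟩ : Heis n) ∈ Nsub n m at hy
            have := mul_mem hx hy
            have e : (⟨(m : ℤ) • (x + y), 0, 0⟩ : Heis n) =
              ⟨(m : ℤ) • x, 0, 0⟩ * ⟨(m : ℤ) • y, 0, 0⟩ := by ext <;> simp [mul_add]
            simpa only [Set.mem_ofPred_eq, e] using this
          neg_mem' := by
            intro x hx
            change (⟨(m : ℤ) • x, 0, 0⟩ : Heis n) ∈ Nsub n m at hx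
            have := inv_mem hx
            have e : (⟨(m : ℤ) • (-x), 0, 0⟩ : Heis n) =
              (⟨(m : ℤ) • x, 0, 0⟩)⁻¹ := by ext <;> simp
            simpa only [Set.mem_ofPred_eq, e] using this }
      intro v
      change v ∈ S
      rw [← Finset.univ_sum_single v]
      refine sum_mem fun i _ => ?_
      have e : (Pi.single i (v i) : Fin n → ℤ) = v i • Pi.single i 1 := by
        rw [← Pi.single_smul]; simp
      rw [e]
      refine zsmul_mem ?_ _
      change (⟨(m : ℤ) • Pi.single i 1, 0, 0⟩ : Heis n) ∈ Nsub n m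
      rw [← Heis.powA_s12, ← xg_fst]
      exact Subgroup.subset_closure (Or.inl ⟨_, by omega, by omega, rfl⟩)
    have hB : ∀ v : Fin n → ℤ, (⟨0, (m : ℤ) • v, 0⟩ : Heis n) ∈ Nsub n m := by
      let S : AddSubgroup (Fin n → ℤ) :=
        { carrier := {v | (⟨0, (m : ℤ) • v, 0⟩ : Heis n) ∈ Nsub n m}
          zero_mem' := by
            have : (⟨0, (m : ℤ) • 0, 0⟩ : Heis n) = 1 := by ext <;> simp
            simp only [Set.mem_ofPred_eq, this, one_mem]
          add_mem' := by
            intro x y hx hy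
            change (⟨0, (m : ℤ) • x, 0⟩ : Heis n) ∈ Nsub n m at hx
            change (⟨0, (m : ℤ) • y, 0⟩ : Heis n) ∈ Nsub n m at hy
            have := mul_mem hx hy
            have e : (⟨0, (m : ℤ) • (x + y), 0⟩ : Heis n) =
              ⟨0, (m : ℤ) • x, 0⟩ * ⟨0, (m : ℤ) • y, 0⟩ := by ext <;> simp [mul_add]
            simpa only [Set.mem_ofPred_eq, e] using this
          neg_mem' := by
            intro x hx
            change (⟨0, (m : ℤ) • x, 0⟩ : Heis n) ∈ Nsub n m at hx
            have := inv_mem hx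
            have e : (⟨0, (m : ℤ) • (-x), 0⟩ : Heis n) =
              (⟨0, (m : ℤ) • x, 0⟩)⁻¹ := by ext <;> simp
            simpa only [Set.mem_ofPred_eq, e] using this }
      intro v
      change v ∈ S
      rw [← Finset.univ_sum_single v]
      refine sum_mem fun i _ => ?_
      have e : (Pi.single i (v i) : Fin n → ℤ) = v i • Pi.single i 1 := by
        rw [← Pi.single_smul]; simp
      rw [e]
      refine zsmul_mem ?_ _
      change (⟨0, (m : ℤ) • Pi.single i 1, 0⟩ : Heis n) ∈ Nsub n m
      rw [← Heis.powB_s12, ← xg_snd]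
      exact Subgroup.subset_closure (Or.inl ⟨_, by omega, by omega, rfl⟩)
    have hC : (⟨0, 0, (m : ℤ) * c'⟩ : Heis n) ∈ Nsub n m := by
      have : (⟨0, 0, (m : ℤ) * c'⟩ : Heis n) = (zz n ^ m) ^ c' := by
        rw [Heis.powC, Heis.zpowC, mul_comm]
      rw [this]
      have hz : zz n ^ m ∈ Nsub n m := Subgroup.subset_closure (Or.inr rfl)
      exact zpow_mem hz _
    have : (⟨a, b, (m : ℤ) * c'⟩ : Heis n) =
        ⟨0, (m : ℤ) • b', 0⟩ * ⟨(m : ℤ) • a', 0, 0⟩ * ⟨0, 0, (m : ℤ) * c'⟩ := by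
      ext <;> simp [ha, hb]
    rw [this]
    exact mul_mem (mul_mem (hB _) (hA _)) hC

lemma mem_Ncong {n m : ℕ} (g : Heis n) : g ∈ Ncong n m ↔
    (∀ i, (m : ℤ) ∣ g.a i) ∧ (∀ i, (m : ℤ) ∣ g.b i) ∧ (m : ℤ) ∣ g.c := Iff.rfl

/-- Coordinates mod `m`. -/
def Fcoord (n m : ℕ) (g : Heis n) : (Fin n → ZMod m) × (Fin n → ZMod m) × ZMod m :=
  (fun i => (g.a i : ZMod m), fun i => (g.b i : ZMod m), (g.c : ZMod m))

lemma Fcoord_eq_iff {n m : ℕ} (g h : Heis n) :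
    Fcoord n m g = Fcoord n m h ↔ g⁻¹ * h ∈ Ncong n m := by
  rw [mem_Ncong]
  simp only [Fcoord, Prod.mk.injEq, funext_iff, Heis.mul_a, Heis.mul_b, Heis.mul_c, Heis.inv_a,
    Heis.inv_b, Heis.inv_c, Pi.add_apply, Pi.neg_apply, ← ZMod.intCast_zmod_eq_zero_iff_dvd]
  push_cast
  simp only [neg_mul, Finset.sum_neg_distrib, neg_add_eq_zero]
  refine and_congr Iff.rfl (and_congr_right fun hb => ?_)
  simp only [hb]
  rw [← sub_eq_zero, ← neg_eq_zero]
  ring_nf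

/-- The abelianized coordinates mod `m`. -/
def phi (n m : ℕ) : Heis n →* Multiplicative (Fin (2 * n) → ZMod m) where
  toFun g := Multiplicative.ofAdd fun j =>
    if h : (j : ℕ) < n then (g.a ⟨j, h⟩ : ZMod m)
    else (g.b ⟨j - n, by omega⟩ : ZMod m)
  map_one' := by
    apply Multiplicative.toAdd.injective
    ext j; simp
  map_mul' x y := by
    apply Multiplicative.toAdd.injective
    ext j
    simp only [toAdd_ofAdd, toAdd_mul, Pi.add_apply]
    split_ifs <;> simp

lemma phi_eq_one {n m : ℕ} (g : Heis n) : phi n m g = 1 ↔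
    (∀ i, (m : ℤ) ∣ g.a i) ∧ (∀ i, (m : ℤ) ∣ g.b i) := by
  rw [← Multiplicative.toAdd.injective.eq_iff, funext_iff]
  simp only [phi, MonoidHom.coe_mk, OneHom.coe_mk, toAdd_ofAdd, toAdd_one, Pi.zero_apply,
    ← ZMod.intCast_zmod_eq_zero_iff_dvd]
  constructor
  · intro h
    refine ⟨fun i => ?_, fun i => ?_⟩
    · simpa using h ⟨i, by omega⟩
    · simpa using h ⟨n + i, by omega⟩
  · rintro ⟨h1, h2⟩ j
    split_ifs
    · exact h1 _
    · exact h2 _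

lemma phi_surjective (n m : ℕ) : Function.Surjective (phi n m) := by
  intro f
  refine ⟨⟨fun i => (f.toAdd ⟨i, by omega⟩).cast, fun i => (f.toAdd ⟨n + i, by omega⟩).cast, 0⟩, ?_⟩
  apply Multiplicative.toAdd.injective
  ext j
  simp only [phi, MonoidHom.coe_mk, OneHom.coe_mk, toAdd_ofAdd, ZMod.intCast_zmod_cast]
  split_ifs with h
  · rfl
  · have h3 : (⟨n + ((j : ℕ) - n), by omega⟩ : Fin (2 * n)) = j := by
      ext; simp; omega
    rw [h3]

theorem quotient_Nsub_extraspecial (n m k : ℕ) (hn : 1 ≤ n)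
    (hk : k = 2 * n + 1) (hm : Nat.Prime m) (hmodd : Odd m)
    (N : Subgroup (Heis n)) (hN : N = Nsub n m) [N.Normal] :
    Nat.card (Heis n ⧸ N) = m ^ k ∧
    Nat.card (Subgroup.center (Heis n ⧸ N)) = m ∧
    Subgroup.center (Heis n ⧸ N) = commutator (Heis n ⧸ N) ∧
    Nonempty (((Heis n ⧸ N) ⧸ Subgroup.center (Heis n ⧸ N)) ≃*
      Multiplicative (Fin (2 * n) → ZMod m)) := by
  rw [Nsub_eq_Ncong] at hN
  have hmpos : 0 < m := hm.pos
  haveI : NeZero m := ⟨hmpos.ne'⟩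
  -- cardinality
  have hcard : Nat.card (Heis n ⧸ N) = m ^ k := by
    let f : Heis n ⧸ N → (Fin n → ZMod m) × (Fin n → ZMod m) × ZMod m :=
      Quotient.lift (Fcoord n m) (fun g h hgh => by
        rw [Fcoord_eq_iff, ← hN]; exact QuotientGroup.leftRel_apply.1 hgh)
    have hf : Function.Bijective f := by
      constructor
      · intro x y
        induction x using QuotientGroup.induction_on with | H x => ?_
        induction y using QuotientGroup.induction_on with | H y => ?_
        intro h
        change Fcoord n m x = Fcoord n m y at h
        rw [Fcoord_eq_iff, ← hN] at h
        exact QuotientGroup.eq.2 h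
      · rintro ⟨a, b, c⟩
        refine ⟨QuotientGroup.mk ⟨fun i => (a i).cast, fun i => (b i).cast, c.cast⟩, ?_⟩
        change Fcoord n m _ = _
        simp [Fcoord]
    rw [Nat.card_congr (Equiv.ofBijective f hf)]
    simp [Nat.card_prod, hk]
    ring
  -- the map to the elementary abelian group
  let ψ : Heis n ⧸ N →* Multiplicative (Fin (2 * n) → ZMod m) :=
    QuotientGroup.lift N (phi n m) (fun g hg => by
      rw [hN] at hg
      exact (phi_eq_one g).2 ⟨hg.1, hg.2.1⟩)
  have hψ : ∀ g : Heis n, ψ (g : Heis n ⧸ N) = phi n m g := fun g => rfl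
  have hψs : Function.Surjective ψ := fun y => by
    obtain ⟨g, rfl⟩ := phi_surjective n m y
    exact ⟨g, rfl⟩
  have hker_comm : ψ.ker ≤ commutator (Heis n ⧸ N) := by
    intro x hx
    induction x using QuotientGroup.induction_on with | H g => ?_
    rw [MonoidHom.mem_ker, hψ, phi_eq_one] at hx
    let i0 : Fin n := ⟨0, hn⟩
    let u : Heis n := ⟨Pi.single i0 g.c, 0, 0⟩
    let v : Heis n := ⟨0, Pi.single i0 1, 0⟩
    have huv : ⁅u, v⁆ = ⟨0, 0, g.c⟩ := by
      rw [commutatorElement_def]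
      ext <;> simp [u, v, Pi.single_apply]
    have : (g : Heis n ⧸ N) = ⁅(u : Heis n ⧸ N), (v : Heis n ⧸ N)⁆ := by
      have : ⁅(u : Heis n ⧸ N), (v : Heis n ⧸ N)⁆ = ((⁅u, v⁆ : Heis n) : Heis n ⧸ N) := rfl
      rw [this, huv, QuotientGroup.eq, hN, ← Fcoord_eq_iff]
      simp only [Fcoord, Prod.mk.injEq, funext_iff]
      simpa [ZMod.intCast_zmod_eq_zero_iff_dvd] using hx
    rw [this]
    exact Subgroup.commutator_mem_commutator (Subgroup.mem_top _) (Subgroup.mem_top _)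
  have hcomm_ker : commutator (Heis n ⧸ N) ≤ ψ.ker := Abelianization.commutator_subset_ker ψ
  have hcomm_iff : ∀ g h : Heis n, ((g : Heis n ⧸ N) * h = h * g) ↔
      (m : ℤ) ∣ (∑ i, h.a i * g.b i) - ∑ i, g.a i * h.b i := by
    intro g h
    rw [← QuotientGroup.mk_mul, ← QuotientGroup.mk_mul, QuotientGroup.eq, hN, ← Fcoord_eq_iff,
      ← ZMod.intCast_zmod_eq_zero_iff_dvd]
    simp only [Fcoord, Prod.mk.injEq, Heis.mul_a, Heis.mul_b, Heis.mul_c, add_comm h.a,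
      add_comm h.b, true_and]
    push_cast
    rw [add_comm (h.c : ZMod m), add_right_inj, sub_eq_zero, eq_comm]
  have hcenter : Subgroup.center (Heis n ⧸ N) = ψ.ker := by
    ext x
    induction x using QuotientGroup.induction_on with | H g => ?_
    rw [MonoidHom.mem_ker, hψ, phi_eq_one, Subgroup.mem_center_iff]
    constructor
    · intro h
      refine ⟨fun i => ?_, fun i => ?_⟩
      · have := (hcomm_iff _ _).1 (h ((⟨0, Pi.single i 1, 0⟩ : Heis n) : Heis n ⧸ N))
        simpa [Pi.single_apply] using this
      · have := (hcomm_iff _ _).1 (h ((⟨Pi.single i 1, 0, 0⟩ : Heis n) : Heis n ⧸ N))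
        simpa [Pi.single_apply] using this
    · rintro ⟨h1, h2⟩ y
      induction y using QuotientGroup.induction_on with | H y => ?_
      rw [hcomm_iff]
      exact dvd_sub (Finset.dvd_sum fun i _ => (h1 i).mul_right _)
        (Finset.dvd_sum fun i _ => (h2 i).mul_left _)
  have e : ((Heis n ⧸ N) ⧸ Subgroup.center (Heis n ⧸ N)) ≃*
      Multiplicative (Fin (2 * n) → ZMod m) :=
    (QuotientGroup.quotientMulEquivOfEq hcenter).trans
      (QuotientGroup.quotientKerEquivOfSurjective ψ hψs)
  refine ⟨hcard, ?_, ?_, ⟨e⟩⟩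
  · have h := Subgroup.card_eq_card_quotient_mul_card_subgroup (Subgroup.center (Heis n ⧸ N))
    have h2 : Nat.card (Multiplicative (Fin (2 * n) → ZMod m)) = m ^ (2 * n) := by
      rw [Nat.card_congr Multiplicative.toAdd]; simp
    rw [hcard, Nat.card_congr e.toEquiv, h2, hk, pow_succ] at h
    exact (Nat.eq_of_mul_eq_mul_left (pow_pos hmpos _) h).symm
  · rw [hcenter]
    exact le_antisymm hker_comm hcomm_ker
end
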